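/- The two-way atomic decomposition has no impact on termination and sometimes-termination of the Datalog-first restricted chase: for every rule set 𝓡, 𝓡 ∈ CT_{df-R}^∀ if and only if 2ad(𝓡) ∈ CT_{df-R}^∀, and 𝓡 ∈ CT_{df-R}^∃ if and only if 2ad(𝓡) ∈ CT_{df-R}^∃. -/

import Mathlib

namespace ExRules

open scoped Classical

noncomputable section

/-- Terms: constants or variables, each indexed by a natural number. -/
inductive Term where
  | const : ℕ → Term
  | var : ℕ → Term
deriving DecidableEq

/-- An atom: a predicate symbol applied to a list of terms (the arity of the
predicate is the length of the argument list). -/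
structure Atom where
  pred : ℕ
  args : List Term
deriving DecidableEq

/-- A factbase is a finite set of atoms. -/
abbrev FactBase := Finset Atom

/-- A substitution: a map on variables (extended by the identity on constants). -/
abbrev Subst := ℕ → Term

def applyTerm (σ : Subst) : Term → Term
  | .const c => .const c
  | .var v => σ v

def Atom.subst (σ : Subst) (a : Atom) : Atom := ⟨a.pred, a.args.map (applyTerm σ)⟩

def Term.vars : Term → Finset ℕ
  | .const _ => ∅
  | .var v => {v}

def Atom.vars (a : Atom) : Finset ℕ := a.args.foldr (fun t s => t.vars ∪ s) ∅

def FactBase.vars (F : FactBase) : Finset ℕ := F.sup Atom.vars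

/-- The variables occurring in a (possibly infinite) set of atoms. -/
def setVars (S : Set Atom) : Set ℕ := {v | ∃ a ∈ S, v ∈ a.vars}

/-- `σ` is a homomorphism from the atom set `S` to the atom set `S'`. -/
def IsHom (σ : Subst) (S S' : Set Atom) : Prop := ∀ a ∈ S, a.subst σ ∈ S'

/-- A retraction is a homomorphism that is the identity on the common variables. -/
def IsRetraction (σ : Subst) (S S' : Set Atom) : Prop :=
  IsHom σ S S' ∧ ∀ v, v ∈ setVars S → v ∈ setVars S' → σ v = Term.var v

/-- An existential rule `B → ∃z.H` with nonempty body and head.  The frontier and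
the existential variables are determined by the variables shared between body and
head. -/
structure Rule where
  body : Finset Atom
  head : Finset Atom
  body_nonempty : body.Nonempty
  head_nonempty : head.Nonempty

instance : DecidableEq Rule := fun R S =>
  decidable_of_iff (R.body = S.body ∧ R.head = S.head) (by
    constructor
    · rintro ⟨h1, h2⟩
      cases R; cases S; simp_all
    · rintro rfl; exact ⟨rfl, rfl⟩)

/-- The frontier of a rule: the variables shared by body and head. -/
def Rule.frontier (R : Rule) : Finset ℕ := FactBase.vars R.body ∩ FactBase.vars R.head

/-- The existential variables of a rule: head variables not occurring in the body. -/
def Rule.exVars (R : Rule) : Finset ℕ := FactBase.vars R.head \ FactBase.vars R.body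

/-- A rule is Datalog if it has no existential variable. -/
def Rule.IsDatalog (R : Rule) : Prop := R.exVars = ∅

/-- A rule has an atomic head if its head is a single atom. -/
def Rule.IsAtomicHead (R : Rule) : Prop := R.head.card = 1

/-- A rule set is a finite set of existential rules. -/
abbrev RuleSet := Finset Rule

instance : Encodable Term :=
  Encodable.ofEquiv (ℕ ⊕ ℕ)
    { toFun := fun t => match t with | .const c => .inl c | .var v => .inr v
      invFun := fun s => match s with | .inl c => .const c | .inr v => .var v
      left_inv := by intro t; cases t <;> rfl
      right_inv := by intro s; cases s <;> rfl }

instance : Encodable Atom :=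
  Encodable.ofEquiv (ℕ × List Term)
    { toFun := fun a => (a.pred, a.args)
      invFun := fun p => ⟨p.1, p.2⟩
      left_inv := fun _ => rfl
      right_inv := fun _ => rfl }

instance : Encodable Rule :=
  Encodable.ofEquiv {p : Finset Atom × Finset Atom // p.1.Nonempty ∧ p.2.Nonempty}
    { toFun := fun R => ⟨(R.body, R.head), R.body_nonempty, R.head_nonempty⟩
      invFun := fun p => ⟨p.1.1, p.1.2, p.2.1, p.2.2⟩
      left_inv := fun _ => rfl
      right_inv := fun _ => rfl }

/-- A trigger `(R, π)`: a rule together with a substitution. -/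
structure Trigger where
  rule : Rule
  map : Subst

/-- The canonical fresh variable `z_t` associated to a trigger `t` and an
existential variable `z`: it is unique for `z` and (the relevant part of) `t`. -/
def Trigger.freshVar (t : Trigger) (z : ℕ) : ℕ :=
  Nat.pair
    (Encodable.encode (t.rule, ((FactBase.vars t.rule.body).sort (· ≤ ·)).map t.map)) z

/-- The extension `π_R` of the substitution of a trigger, mapping each existential
variable `z` to the fresh variable `z_t`. -/
def Trigger.ext (t : Trigger) : Subst := fun v =>
  if v ∈ t.rule.exVars then Term.var (t.freshVar v) else t.map v

/-- The output of a trigger: `out(t) = π_R(H)`. -/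
def Trigger.out (t : Trigger) : Finset Atom := t.rule.head.image (Atom.subst t.ext)

/-- `t` is a trigger on the factbase `F`: its substitution is a homomorphism from
the body of its rule to `F`. -/
def Trigger.IsOn (t : Trigger) (F : FactBase) : Prop := IsHom t.map ↑t.rule.body ↑F

/-- The chase variants: oblivious, semi-oblivious, restricted, equivalent. -/
inductive Variant where
  | O | SO | R | E

/-- Applicability of a trigger on a factbase, for each chase variant. -/
def Applicable : Variant → Trigger → FactBase → Prop
  | .O, t, F => ¬ t.out ⊆ F
  | .SO, t, F => ∀ t' : Trigger, t'.rule = t.rule →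
      (∀ v ∈ t.rule.frontier, t'.map v = t.map v) → ¬ t'.out ⊆ F
  | .R, t, F => ¬ ∃ σ : Subst, IsRetraction σ ↑(F ∪ t.out) ↑F
  | .E, t, F => ¬ ∃ σ : Subst, IsHom σ ↑(F ∪ t.out) ↑F

/-- An atom set `M` satisfies a rule `B → ∃z.H` if every homomorphism from `B`
to `M` extends to a homomorphism mapping `H` into `M`. -/
def SatisfiesRule (M : Set Atom) (R : Rule) : Prop :=
  ∀ σ : Subst, IsHom σ ↑R.body M →
    ∃ σ' : Subst, (∀ v ∈ FactBase.vars R.body, σ' v = σ v) ∧ IsHom σ' ↑R.head M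

/-- A (finite or infinite) derivation from the knowledge base `⟨𝓡, F⟩`:
`len` is the number of triggers (possibly `⊤`), `fb i` is the `i`-th factbase and,
for `i < len`, `tr i` is the trigger producing `fb (i+1)` from `fb i`. -/
structure Derivation (𝓡 : RuleSet) (F : FactBase) where
  len : ℕ∞
  fb : ℕ → FactBase
  tr : ℕ → Trigger
  fb_zero : fb 0 = F
  rule_mem : ∀ i : ℕ, (i : ℕ∞) < len → (tr i).rule ∈ 𝓡
  trig_on : ∀ i : ℕ, (i : ℕ∞) < len → (tr i).IsOn (fb i)
  trig_new : ∀ i : ℕ, (i : ℕ∞) < len → ¬ (tr i).out ⊆ fb i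
  fb_succ : ∀ i : ℕ, (i : ℕ∞) < len → fb (i + 1) = fb i ∪ (tr i).out
  fb_stall : ∀ i : ℕ, ¬ (i : ℕ∞) < len → fb (i + 1) = fb i

namespace Derivation

variable {𝓡 : RuleSet} {F : FactBase}

/-- An `X`-derivation: every applied trigger is `X`-applicable when applied. -/
def IsX (X : Variant) (D : Derivation 𝓡 F) : Prop :=
  ∀ i : ℕ, (i : ℕ∞) < D.len → Applicable X (D.tr i) (D.fb i)

/-- Datalog-first: a non-Datalog rule is only applied when all Datalog rules of
the rule set are satisfied. -/
def DatalogFirst (D : Derivation 𝓡 F) : Prop :=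
  ∀ i : ℕ, (i : ℕ∞) < D.len → ¬ (D.tr i).rule.IsDatalog →
    ∀ R ∈ 𝓡, R.IsDatalog → SatisfiesRule ↑(D.fb i) R

/-- Fairness: every trigger `X`-applicable on some factbase of the derivation is
eventually not `X`-applicable. -/
def Fair (X : Variant) (D : Derivation 𝓡 F) : Prop :=
  ∀ i : ℕ, (i : ℕ∞) ≤ D.len → ∀ t : Trigger, t.rule ∈ 𝓡 → t.IsOn (D.fb i) →
    Applicable X t (D.fb i) →
    ∃ j : ℕ, i < j ∧ (j : ℕ∞) ≤ D.len ∧ ¬ Applicable X t (D.fb j)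

/-- A derivation is finite if its length is not `⊤`. -/
def Finite (D : Derivation 𝓡 F) : Prop := D.len ≠ ⊤

end Derivation

/-- `CT_X^∀` (non-Datalog-first): every fair `X`-derivation from every KB is finite. -/
def CTall (X : Variant) (𝓡 : RuleSet) : Prop :=
  ∀ F : FactBase, ∀ D : Derivation 𝓡 F, D.IsX X → D.Fair X → D.Finite

/-- `CT_X^∃`: some fair `X`-derivation from every KB is finite. -/
def CTex (X : Variant) (𝓡 : RuleSet) : Prop :=
  ∀ F : FactBase, ∃ D : Derivation 𝓡 F, D.IsX X ∧ D.Fair X ∧ D.Finite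

/-- `CT_{df-X}^∀`: every fair Datalog-first `X`-derivation from every KB is finite. -/
def CTallDF (X : Variant) (𝓡 : RuleSet) : Prop :=
  ∀ F : FactBase, ∀ D : Derivation 𝓡 F, D.IsX X → D.DatalogFirst → D.Fair X → D.Finite

/-- `CT_{df-X}^∃`: some fair Datalog-first `X`-derivation from every KB is finite. -/
def CTexDF (X : Variant) (𝓡 : RuleSet) : Prop :=
  ∀ F : FactBase, ∃ D : Derivation 𝓡 F, D.IsX X ∧ D.DatalogFirst ∧ D.Fair X ∧ D.Finite

/-! ### Single-piece decomposition -/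

/-- Adjacency in the piece graph of a rule: two head atoms sharing an existential
variable. -/
def PieceAdj (R : Rule) (a b : Atom) : Prop :=
  a ∈ R.head ∧ b ∈ R.head ∧ (a.vars ∩ b.vars ∩ R.exVars).Nonempty

/-- The piece (connected component of the piece graph) containing a given head atom. -/
def pieceOf (R : Rule) (a : Atom) : Finset Atom :=
  R.head.filter fun b => Relation.ReflTransGen (PieceAdj R) a b

theorem self_mem_pieceOf {R : Rule} {a : Atom} (h : a ∈ R.head) : a ∈ pieceOf R a := by
  rw [pieceOf, Finset.mem_filter]
  exact ⟨h, Relation.ReflTransGen.refl⟩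

/-- The single-piece decomposition of a rule. -/
def Rule.sp (R : Rule) : Finset Rule :=
  R.head.attach.image fun a =>
    ⟨R.body, pieceOf R a.1, R.body_nonempty, ⟨a.1, self_mem_pieceOf a.2⟩⟩

/-- The single-piece decomposition of a rule set. -/
def spSet (𝓡 : RuleSet) : RuleSet := 𝓡.biUnion Rule.sp

/-! ### Atomic decompositions -/

/-- The predicates occurring in a rule set. -/
def RuleSet.predsF (𝓡 : RuleSet) : Finset ℕ :=
  𝓡.sup fun R => (R.body.image Atom.pred) ∪ (R.head.image Atom.pred)

/-- A fresh predicate `X_R`, unique for `R` and not occurring in `𝓡`. -/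
def freshPred (𝓡 : RuleSet) (R : Rule) : ℕ :=
  (RuleSet.predsF 𝓡).sup id + 1 + Encodable.encode R

/-- The atom `X_R(x, z)` over the fresh predicate, whose arguments are the frontier
variables followed by the existential variables of `R`. -/
def xAtom (𝓡 : RuleSet) (R : Rule) : Atom :=
  ⟨freshPred 𝓡 R,
    ((R.frontier.sort (· ≤ ·)).map Term.var) ++ ((R.exVars.sort (· ≤ ·)).map Term.var)⟩

/-- The one-way atomic decomposition of a rule `R = B → ∃z.H` (relative to `𝓡`):
the rule `B → ∃z.X_R(x,z)` together with a rule `X_R(x,z) → P(t)` for each head atom. -/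
def oneAdRule (𝓡 : RuleSet) (R : Rule) : Finset Rule :=
  insert ⟨R.body, {xAtom 𝓡 R}, R.body_nonempty, Finset.singleton_nonempty _⟩
    (R.head.attach.image fun a =>
      ⟨{xAtom 𝓡 R}, {a.1}, Finset.singleton_nonempty _, Finset.singleton_nonempty _⟩)

/-- The one-way atomic decomposition of a rule set. -/
def oneAd (𝓡 : RuleSet) : RuleSet := 𝓡.biUnion (oneAdRule 𝓡)

/-- The two-way atomic decomposition: `2ad(R) = 1ad(R) ∪ {H[x,z] → X_R(x,z)}`. -/
def twoAd (𝓡 : RuleSet) : RuleSet :=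
  oneAd 𝓡 ∪ 𝓡.image fun R =>
    ⟨R.head, {xAtom 𝓡 R}, R.head_nonempty, Finset.singleton_nonempty _⟩

/-! ### Models, entailment, BDDP -/

/-- `M` is a model of the rule set `𝓡`. -/
def IsModelOfRules (𝓡 : RuleSet) (M : Set Atom) : Prop := ∀ R ∈ 𝓡, SatisfiesRule M R

/-- `M` is a model of the knowledge base `⟨𝓡, F⟩`. -/
def IsModelOfKB (𝓡 : RuleSet) (F : FactBase) (M : Set Atom) : Prop :=
  IsModelOfRules 𝓡 M ∧ ∃ σ : Subst, IsHom σ ↑F M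

/-- `M` is a universal model of `⟨𝓡, F⟩`: a model mapping homomorphically into
every model. -/
def IsUniversalModel (𝓡 : RuleSet) (F : FactBase) (M : Set Atom) : Prop :=
  IsModelOfKB 𝓡 F M ∧ ∀ N : Set Atom, IsModelOfKB 𝓡 F N → ∃ σ : Subst, IsHom σ M N

/-- An atom set entails a Boolean conjunctive query `Q` if `Q` maps
homomorphically into it. -/
def EntailsQ (S : Set Atom) (Q : Finset Atom) : Prop := ∃ σ : Subst, IsHom σ ↑Q S

/-- `⟨𝓡, F⟩ ⊨ Q`: every model of the KB entails `Q`. -/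
def KBEntails (𝓡 : RuleSet) (F : FactBase) (Q : Finset Atom) : Prop :=
  ∀ M : Set Atom, IsModelOfKB 𝓡 F M → EntailsQ M Q

/-- `R(F)`: the minimal atom set including `F` and `out(t)` for every trigger `t`
with rule `R` on `F`. -/
def ruleStep (R : Rule) (S : Set Atom) : Set Atom :=
  S ∪ {a | ∃ t : Trigger, t.rule = R ∧ IsHom t.map ↑R.body S ∧ a ∈ t.out}

/-- `𝓡(F) = ⋃_{R ∈ 𝓡} R(F)` (together with `F`). -/
def setStep (𝓡 : RuleSet) (S : Set Atom) : Set Atom := S ∪ ⋃ R ∈ 𝓡, ruleStep R S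

/-- The breadth-first chase `Ch_i(⟨𝓡, F⟩)`. -/
def ch (𝓡 : RuleSet) (F : FactBase) : ℕ → Set Atom
  | 0 => ↑F
  | i + 1 => setStep 𝓡 (ch 𝓡 F i)

/-- The bounded derivation depth property. -/
def BDDP (𝓡 : RuleSet) : Prop :=
  ∀ Q : Finset Atom, ∃ k : ℕ, ∀ F : FactBase, KBEntails 𝓡 F Q ↔ EntailsQ (ch 𝓡 F k) Q

/-! ### Conservative extensions -/

/-- The restriction of an atom set to the atoms over a given set of predicates. -/
def restrictTo (M : Set Atom) (P : Set ℕ) : Set Atom := {a ∈ M | a.pred ∈ P}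

/-- The terms (domain elements) of an atom set. -/
def termsOf (M : Set Atom) : Set Term := {u | ∃ a ∈ M, u ∈ a.args}

/-- `𝓡'` is a conservative extension of `𝓡`. -/
def ConservativeExt (𝓡 𝓡' : RuleSet) : Prop :=
  (↑(RuleSet.predsF 𝓡) : Set ℕ) ⊆ ↑(RuleSet.predsF 𝓡') ∧
  (∀ M : Set Atom, IsModelOfRules 𝓡' M →
    IsModelOfRules 𝓡 (restrictTo M ↑(RuleSet.predsF 𝓡))) ∧
  (∀ M : Set Atom, IsModelOfRules 𝓡 M →
    ∃ M' : Set Atom, M ⊆ M' ∧ IsModelOfRules 𝓡' M' ∧ termsOf M' = termsOf M ∧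
      restrictTo M' ↑(RuleSet.predsF 𝓡) = restrictTo M ↑(RuleSet.predsF 𝓡))

/-- `𝓡'` is a universal-conservative extension of `𝓡`. -/
def UnivConservativeExt (𝓡 𝓡' : RuleSet) : Prop :=
  (↑(RuleSet.predsF 𝓡) : Set ℕ) ⊆ ↑(RuleSet.predsF 𝓡') ∧
  ∀ F : FactBase, (∀ a ∈ F, a.pred ∈ RuleSet.predsF 𝓡) →
    (∀ M : Set Atom, IsUniversalModel 𝓡' F M →
      IsUniversalModel 𝓡 F (restrictTo M ↑(RuleSet.predsF 𝓡))) ∧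
    (∀ M : Set Atom, IsUniversalModel 𝓡 F M →
      ∃ M' : Set Atom, M ⊆ M' ∧ IsUniversalModel 𝓡' F M' ∧ termsOf M' = termsOf M ∧
        restrictTo M' ↑(RuleSet.predsF 𝓡) = restrictTo M ↑(RuleSet.predsF 𝓡))

/-! ### Atoms and substitutions -/

theorem mem_vars_iff {a : Atom} {v : ℕ} : v ∈ a.vars ↔ Term.var v ∈ a.args := by
  obtain ⟨p, l⟩ := a
  simp only [Atom.vars]
  induction l with
  | nil => simp
  | cons t l ih =>
    rw [List.foldr_cons, Finset.mem_union, ih, List.mem_cons]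
    cases t <;> simp [Term.vars]

theorem mem_factVars_iff {F : FactBase} {v : ℕ} :
    v ∈ FactBase.vars F ↔ ∃ a ∈ F, v ∈ a.vars := by
  simp [FactBase.vars, Finset.mem_sup]

theorem Atom.subst_eq_subst_iff {a : Atom} {σ τ : Subst} :
    a.subst σ = a.subst τ ↔ ∀ v ∈ a.vars, σ v = τ v := by
  simp only [Atom.subst, Atom.mk.injEq, true_and, List.map_inj_left]
  constructor
  · intro h v hv
    exact h _ (mem_vars_iff.1 hv)
  · rintro h (c | v) ht
    · rfl
    · exact h v (mem_vars_iff.2 ht)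

theorem Atom.subst_subst (a : Atom) (σ τ : Subst) :
    (a.subst σ).subst τ = a.subst fun v => applyTerm τ (σ v) := by
  simp only [Atom.subst, List.map_map, Atom.mk.injEq, true_and]
  refine List.map_congr_left ?_
  rintro (c | v) - <;> rfl

theorem Atom.subst_eq_self {a : Atom} {σ : Subst} (h : ∀ v ∈ a.vars, σ v = Term.var v) :
    a.subst σ = a := by
  obtain ⟨p, l⟩ := a
  simp only [Atom.subst, Atom.mk.injEq, true_and]
  conv_rhs => rw [← List.map_id l]
  refine List.map_congr_left ?_
  rintro (c | v) ht
  · rfl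
  · exact h v (mem_vars_iff.2 ht)

theorem Atom.mem_vars_subst {a : Atom} {σ : Subst} {v : ℕ} :
    v ∈ (a.subst σ).vars ↔ ∃ w ∈ a.vars, σ w = Term.var v := by
  rw [mem_vars_iff]
  simp only [Atom.subst, List.mem_map]
  constructor
  · rintro ⟨c | w, hw, h⟩
    · simp [applyTerm] at h
    · exact ⟨w, mem_vars_iff.2 hw, h⟩
  · rintro ⟨w, hw, h⟩
    exact ⟨.var w, mem_vars_iff.1 hw, h⟩

theorem setVars_mono {S S' : Set Atom} (h : S ⊆ S') : setVars S ⊆ setVars S' := by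
  rintro v ⟨a, ha, hv⟩
  exact ⟨a, h ha, hv⟩

theorem Rule.IsDatalog.head_vars_subset {R : Rule} (hR : R.IsDatalog) :
    FactBase.vars R.head ⊆ FactBase.vars R.body :=
  Finset.sdiff_eq_empty_iff_subset.1 hR

theorem Rule.IsDatalog.satisfiesRule_iff {R : Rule} (hR : R.IsDatalog) {M : Set Atom} :
    SatisfiesRule M R ↔ ∀ σ : Subst, IsHom σ ↑R.body M → IsHom σ ↑R.head M := by
  constructor
  · intro h σ hσ a ha
    obtain ⟨σ', h1, h2⟩ := h σ hσ
    rw [Atom.subst_eq_subst_iff.2 fun v hv =>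
      (h1 v (hR.head_vars_subset (mem_factVars_iff.2 ⟨a, ha, hv⟩))).symm]
    exact h2 a ha
  · intro h σ hσ
    exact ⟨σ, fun _ _ => rfl, h σ hσ⟩

/-- All Datalog rules of `𝓡` are satisfied by `M`. -/
def Saturated (𝓡 : RuleSet) (M : Set Atom) : Prop :=
  ∀ R ∈ 𝓡, R.IsDatalog → SatisfiesRule M R

/-! ### Triggers -/

theorem Trigger.IsOn.mono {t : Trigger} {F F' : FactBase} (h : t.IsOn F) (hF : F ⊆ F') :
    t.IsOn F' :=
  fun a ha => hF (h a ha)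

theorem Trigger.IsOn.mem_setVars {t : Trigger} {F : FactBase} (h : t.IsOn F) {v w : ℕ}
    (hw : w ∈ FactBase.vars t.rule.body) (hv : t.map w = Term.var v) : v ∈ setVars ↑F := by
  obtain ⟨b, hb, hwb⟩ := mem_factVars_iff.1 hw
  exact ⟨_, h b hb, Atom.mem_vars_subst.2 ⟨w, hwb, hv⟩⟩

theorem Trigger.mem_out {t : Trigger} {a : Atom} :
    a ∈ t.out ↔ ∃ h ∈ t.rule.head, h.subst t.ext = a := by
  simp [Trigger.out]

/-- The variables of the output of a trigger on `F` are variables of `F` or fresh ones. -/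
theorem Trigger.IsOn.vars_out {t : Trigger} {F : FactBase} (h : t.IsOn F) {v : ℕ}
    (hv : v ∈ setVars ↑t.out) :
    v ∈ setVars ↑F ∨ ∃ z ∈ t.rule.exVars, v = t.freshVar z := by
  obtain ⟨a, ha, hva⟩ := hv
  obtain ⟨b, hb, rfl⟩ := Trigger.mem_out.1 ha
  obtain ⟨w, hw, hwv⟩ := Atom.mem_vars_subst.1 hva
  unfold Trigger.ext at hwv
  split_ifs at hwv with hz
  · exact .inr ⟨w, hz, (Term.var.inj hwv).symm⟩
  · refine .inl (h.mem_setVars ?_ hwv)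
    by_contra hb'
    exact hz (Finset.mem_sdiff.2 ⟨mem_factVars_iff.2 ⟨b, hb, hw⟩, hb'⟩)

theorem Trigger.out_eq_of_freshVar_eq {t u : Trigger} {z z' : ℕ}
    (h : t.freshVar z = u.freshVar z') : t.out = u.out := by
  obtain ⟨R, π⟩ := t
  obtain ⟨S, π'⟩ := u
  have h1 := Encodable.encode_injective (Nat.pair_eq_pair.1 h).1
  simp only [Prod.mk.injEq] at h1
  obtain ⟨rfl, h2⟩ := h1
  have h3 : ∀ v ∈ FactBase.vars R.body, π v = π' v := fun v hv =>
    List.map_inj_left.1 h2 v ((Finset.mem_sort _).2 hv)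
  refine Finset.image_congr fun a ha => Atom.subst_eq_subst_iff.2 fun v hv => ?_
  by_cases hz : v ∈ R.exVars
  · simp [Trigger.ext, hz, Trigger.freshVar, h2]
  · simp only [Trigger.ext, hz, if_false]
    refine h3 v ?_
    by_contra hb
    exact hz (Finset.mem_sdiff.2 ⟨mem_factVars_iff.2 ⟨a, ha, hv⟩, hb⟩)

/-- A trigger is not `R`-applicable iff its output folds into `F` by a map fixing the
variables of `F`. -/
theorem not_applicable_iff {t : Trigger} {F : FactBase} :
    ¬ Applicable .R t F ↔
      ∃ σ : Subst, (∀ v ∈ setVars ↑F, σ v = Term.var v) ∧ ∀ a ∈ t.out, a.subst σ ∈ F := by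
  simp only [Applicable, not_not, IsRetraction, IsHom]
  refine exists_congr fun σ => ⟨?_, ?_⟩
  · rintro ⟨h1, h2⟩
    exact ⟨fun v hv => h2 v (setVars_mono (by simp) hv) hv, fun a ha => h1 a (by simp [ha])⟩
  · rintro ⟨h1, h2⟩
    refine ⟨fun a ha => ?_, fun v _ hv => h1 v hv⟩
    rcases Finset.mem_union.1 ha with ha | ha
    · rwa [Atom.subst_eq_self fun v hv => h1 v ⟨a, ha, hv⟩]
    · exact h2 a ha

theorem not_applicable_of_subset {t : Trigger} {F : FactBase} (h : t.out ⊆ F) :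
    ¬ Applicable .R t F :=
  not_applicable_iff.2 ⟨Term.var, fun _ _ => rfl, fun a ha => by
    rw [Atom.subst_eq_self fun _ _ => rfl]; exact h ha⟩

theorem Trigger.ext_eq_map {t : Trigger} (hd : t.rule.IsDatalog) : t.ext = t.map := by
  funext v
  have : t.rule.exVars = ∅ := hd
  simp [Trigger.ext, this]

theorem Saturated.out_subset {𝓡 : RuleSet} {M : Set Atom} (hM : Saturated 𝓡 M) {t : Trigger}
    (ht : t.rule ∈ 𝓡) (hd : t.rule.IsDatalog) (hF : IsHom t.map ↑t.rule.body M) :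
    ↑t.out ⊆ M := by
  intro a ha
  obtain ⟨b, hb, rfl⟩ := Trigger.mem_out.1 ha
  rw [Trigger.ext_eq_map hd]
  exact hd.satisfiesRule_iff.1 (hM _ ht hd) t.map hF b hb

theorem Saturated.not_applicable {𝓡 : RuleSet} {F : FactBase} (h : Saturated 𝓡 ↑F)
    {t : Trigger} (ht : t.rule ∈ 𝓡) (hd : t.rule.IsDatalog) (hF : t.IsOn F) :
    ¬ Applicable .R t F :=
  not_applicable_of_subset (h.out_subset ht hd hF)

theorem applicable_of_isDatalog {F : FactBase} {t : Trigger} (hd : t.rule.IsDatalog)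
    (hF : t.IsOn F) (h : ¬ t.out ⊆ F) : Applicable .R t F := by
  by_contra hn
  obtain ⟨σ, h1, h2⟩ := not_applicable_iff.1 hn
  refine h fun a ha => ?_
  rw [← Atom.subst_eq_self (a := a) (σ := σ)]
  · exact h2 a ha
  · intro v hv
    refine h1 v ?_
    rcases hF.vars_out ⟨a, ha, hv⟩ with h | ⟨z, hz, -⟩
    · exact h
    · have : t.rule.exVars = ∅ := hd
      simp [this] at hz

/-! ### Steps of the Datalog-first restricted chase -/

/-- One step of the Datalog-first restricted chase. -/
def Step (𝓡 : RuleSet) (F F' : FactBase) : Prop :=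
  ∃ t : Trigger, t.rule ∈ 𝓡 ∧ t.IsOn F ∧ Applicable .R t F ∧
    (¬ t.rule.IsDatalog → Saturated 𝓡 ↑F) ∧ F' = F ∪ t.out

theorem Step.subset {𝓡 : RuleSet} {F F' : FactBase} (h : Step 𝓡 F F') : F ⊆ F' := by
  obtain ⟨t, -, -, -, -, rfl⟩ := h
  exact Finset.subset_union_left

theorem subset_of_steps {𝓡 : RuleSet} {F F' : FactBase}
    (h : Relation.ReflTransGen (Step 𝓡) F F') : F ⊆ F' := by
  induction h with
  | refl => exact subset_rfl
  | tail _ h ih => exact ih.trans h.subset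

/-- Non-applicability persists along chase steps. -/
theorem Step.not_applicable {𝓡 : RuleSet} {F F' : FactBase} (h : Step 𝓡 F F') {t : Trigger}
    (ht : t.IsOn F) (hn : ¬ Applicable .R t F) : ¬ Applicable .R t F' := by
  obtain ⟨u, -, hu, -, -, rfl⟩ := h
  by_cases hc : ∃ z ∈ t.rule.exVars,
      t.freshVar z ∈ setVars ↑(F ∪ u.out) ∧ t.freshVar z ∉ setVars ↑F
  · obtain ⟨z, -, ⟨a, ha, hza⟩, hzF⟩ := hc
    have ha' : a ∈ u.out := (Finset.mem_union.1 ha).resolve_left fun h => hzF ⟨a, h, hza⟩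
    obtain ⟨z', -, hz'⟩ := (hu.vars_out ⟨a, ha', hza⟩).resolve_left hzF
    refine not_applicable_of_subset ?_
    rw [Trigger.out_eq_of_freshVar_eq hz']
    exact Finset.subset_union_right
  · push Not at hc
    obtain ⟨σ, h1, h2⟩ := not_applicable_iff.1 hn
    refine not_applicable_iff.2
      ⟨fun v => if v ∈ setVars ↑(F ∪ u.out) then Term.var v else σ v,
        fun v hv => if_pos hv, fun a ha => ?_⟩
    refine Finset.mem_union_left _ ?_
    convert h2 a ha using 1
    refine Atom.subst_eq_subst_iff.2 fun v hv => ?_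
    split_ifs with hv'
    · symm
      refine h1 v ?_
      rcases ht.vars_out ⟨a, ha, hv⟩ with h | ⟨z, hz, rfl⟩
      · exact h
      · exact hc z hz hv'
    · rfl

theorem not_applicable_of_steps {𝓡 : RuleSet} {F F' : FactBase}
    (h : Relation.ReflTransGen (Step 𝓡) F F') {t : Trigger}
    (ht : t.IsOn F) (hn : ¬ Applicable .R t F) : ¬ Applicable .R t F' := by
  induction h with
  | refl => exact hn
  | tail h1 h2 ih => exact h2.not_applicable (ht.mono (subset_of_steps h1)) ih

/-! ### Datalog closure -/

theorem finite_lists_over {T : Set Term} (hT : T.Finite) (n : ℕ) :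
    {l : List Term | l.length = n ∧ ∀ t ∈ l, t ∈ T}.Finite := by
  induction n with
  | zero => exact (Set.finite_singleton []).subset fun l hl => List.length_eq_zero_iff.1 hl.1
  | succ n ih =>
    refine (hT.image2 List.cons ih).subset ?_
    rintro (_ | ⟨t, l⟩) ⟨h1, h2⟩
    · simp at h1
    · exact ⟨t, h2 t (by simp), l, ⟨by simpa using h1, fun s hs => h2 s (by simp [hs])⟩, rfl⟩

/-- A finite set of atoms bounding the Datalog closure of `F`. -/
def datalogBound (𝓡 : RuleSet) (F : FactBase) : Set Atom :=
  {a | (a ∈ F ∨ ∃ R ∈ 𝓡, ∃ h ∈ R.head, a.pred = h.pred ∧ a.args.length = h.args.length) ∧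
    ∀ t ∈ a.args, t ∈ termsOf ↑F ∪ ⋃ R ∈ 𝓡, termsOf ↑R.head}

theorem termsOf_finite (F : FactBase) : (termsOf ↑F).Finite := by
  have : termsOf ↑F = ⋃ a ∈ F, {t | t ∈ a.args} := by ext; simp [termsOf]
  rw [this]
  exact F.finite_toSet.biUnion fun a _ => List.finite_toSet _

theorem datalogBound_finite (𝓡 : RuleSet) (F : FactBase) : (datalogBound 𝓡 F).Finite := by
  have hT : (termsOf ↑F ∪ ⋃ R ∈ 𝓡, termsOf ↑R.head).Finite :=
    (termsOf_finite F).union (𝓡.finite_toSet.biUnion fun R _ => termsOf_finite R.head)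
  set T := termsOf ↑F ∪ ⋃ R ∈ 𝓡, termsOf ↑R.head with hTdef
  refine (F.finite_toSet.union (𝓡.finite_toSet.biUnion fun R _ => R.head.finite_toSet.biUnion
    fun h _ => ((finite_lists_over hT h.args.length).image (Atom.mk h.pred)))).subset ?_
  rintro ⟨p, l⟩ ⟨ha | ⟨R, hR, h, hh, hp, hl⟩, ht⟩
  · exact .inl ha
  · right
    simp only [Set.mem_iUnion]
    exact ⟨R, hR, h, hh, l, ⟨hl, ht⟩, by rw [← hp]⟩

theorem Trigger.IsOn.out_subset_datalogBound {𝓡 : RuleSet} {F F' : FactBase} {t : Trigger}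
    (ht : t.rule ∈ 𝓡) (hd : t.rule.IsDatalog) (hF' : ↑F' ⊆ datalogBound 𝓡 F)
    (hF : t.IsOn F') : ↑t.out ⊆ datalogBound 𝓡 F := by
  intro a ha
  obtain ⟨h, hh, rfl⟩ := Trigger.mem_out.1 ha
  refine ⟨.inr ⟨_, ht, h, hh, rfl, by simp [Atom.subst]⟩, fun s hs => ?_⟩
  have hd' : t.rule.exVars = ∅ := hd
  simp only [Atom.subst, List.mem_map] at hs
  obtain ⟨c | v, hv, rfl⟩ := hs
  · right
    simp only [Set.mem_iUnion]
    exact ⟨_, ht, h, hh, hv⟩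
  · obtain ⟨b, hb, hvb⟩ := mem_factVars_iff.1
      (hd.head_vars_subset (mem_factVars_iff.2 ⟨h, hh, mem_vars_iff.2 hv⟩))
    refine (hF' (hF b hb)).2 _ ?_
    simp only [applyTerm, Trigger.ext, hd', Finset.notMem_empty, if_false, Atom.subst,
      List.mem_map]
    exact ⟨.var v, mem_vars_iff.1 hvb, rfl⟩

/-- `F'` is the Datalog closure of `F`. -/
structure IsClosure (𝓡 : RuleSet) (F F' : FactBase) : Prop where
  steps : Relation.ReflTransGen (Step 𝓡) F F'
  saturated : Saturated 𝓡 ↑F'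
  least : ∀ M : Set Atom, ↑F ⊆ M → Saturated 𝓡 M → ↑F' ⊆ M

theorem exists_isClosure (𝓡 : RuleSet) (F : FactBase) : ∃ F', IsClosure 𝓡 F F' := by
  have key : ∀ n : ℕ, ∀ F₁ : FactBase, (datalogBound_finite 𝓡 F).toFinset.card - F₁.card = n →
      ↑F₁ ⊆ datalogBound 𝓡 F → ∃ F', IsClosure 𝓡 F₁ F' := by
    intro n
    induction n using Nat.strong_induction_on with
    | _ n ih =>
      intro F₁ hn hF₁
      by_cases hs : Saturated 𝓡 ↑F₁
      · exact ⟨F₁, .refl, hs, fun M hM _ => hM⟩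
      · simp only [Saturated, not_forall] at hs
        obtain ⟨R, hR, hd, hs⟩ := hs
        rw [hd.satisfiesRule_iff] at hs
        push Not at hs
        obtain ⟨σ, hb, hh⟩ := hs
        set t : Trigger := ⟨R, σ⟩ with htdef
        have hon : t.IsOn F₁ := hb
        have hnew : ¬ t.out ⊆ F₁ := fun h => hh fun a ha =>
          h (Trigger.mem_out.2 ⟨a, ha, by rw [Trigger.ext_eq_map (t := t) hd]⟩)
        have hstep : Step 𝓡 F₁ (F₁ ∪ t.out) :=
          ⟨t, hR, hon, applicable_of_isDatalog hd hon hnew, fun h => absurd hd h, rfl⟩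
        have hsub : ↑(F₁ ∪ t.out) ⊆ datalogBound 𝓡 F := by
          rw [Finset.coe_union]
          exact Set.union_subset hF₁ (hon.out_subset_datalogBound hR hd hF₁)
        have hlt : F₁.card < (F₁ ∪ t.out).card := Finset.card_lt_card
          ⟨Finset.subset_union_left, fun h => hnew (Finset.subset_union_right.trans h)⟩
        have hle : (F₁ ∪ t.out).card ≤ (datalogBound_finite 𝓡 F).toFinset.card :=
          Finset.card_le_card fun a ha => (Set.Finite.mem_toFinset _).2 (hsub ha)
        obtain ⟨F', h⟩ := ih _ (by omega) (F₁ ∪ t.out) rfl hsub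
        refine ⟨F', .head hstep h.steps, h.saturated, fun M hM hsat => h.least M ?_ hsat⟩
        rw [Finset.coe_union]
        exact Set.union_subset hM (hsat.out_subset hR hd fun a ha => hM (hb a ha))
  refine key _ F rfl fun a ha => ⟨.inl ha, fun t ht => .inl ⟨a, ha, ht⟩⟩

theorem IsClosure.subset {𝓡 : RuleSet} {F F' : FactBase} (h : IsClosure 𝓡 F F') : F ⊆ F' :=
  subset_of_steps h.steps

theorem IsClosure.unique {𝓡 : RuleSet} {F F₁ F₂ : FactBase} (h₁ : IsClosure 𝓡 F F₁)
    (h₂ : IsClosure 𝓡 F F₂) : F₁ = F₂ :=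
  Finset.Subset.antisymm (h₁.least _ h₂.subset h₂.saturated)
    (h₂.least _ h₁.subset h₁.saturated)

/-- A Datalog closure contains no new variables. -/
theorem IsClosure.setVars_eq {𝓡 : RuleSet} {F F' : FactBase} (h : IsClosure 𝓡 F F') :
    setVars ↑F' = setVars ↑F := by
  refine Set.Subset.antisymm ?_ (setVars_mono h.subset)
  have := h.least {a | ∀ v ∈ a.vars, v ∈ setVars ↑F} (fun a ha v hv => ⟨a, ha, hv⟩) ?_
  · rintro v ⟨a, ha, hv⟩
    exact this ha v hv
  · intro R _ hd
    rw [hd.satisfiesRule_iff]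
    intro σ hσ a ha v hv
    obtain ⟨w, hw, hwv⟩ := Atom.mem_vars_subst.1 hv
    obtain ⟨b, hb, hwb⟩ := mem_factVars_iff.1
      (hd.head_vars_subset (mem_factVars_iff.2 ⟨a, ha, hw⟩))
    exact hσ b hb v (Atom.mem_vars_subst.2 ⟨w, hwb, hwv⟩)

/-! ### Paths and derivations -/

theorem extend_path {α : Type*} {r : α → α → Prop} {s : ℕ → α} {n : ℕ} {b : α}
    (hs : ∀ k < n, r (s k) (s (k + 1))) (h : Relation.ReflTransGen r (s n) b) :
    ∃ s' : ℕ → α, ∃ n', n ≤ n' ∧ (∀ k ≤ n, s' k = s k) ∧ s' n' = b ∧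
      ∀ k < n', r (s' k) (s' (k + 1)) := by
  induction h with
  | refl => exact ⟨s, n, le_rfl, fun _ _ => rfl, rfl, hs⟩
  | @tail b c _ hbc ih =>
    obtain ⟨s', n', hn, hagree, hb, hs'⟩ := ih
    refine ⟨Function.update s' (n' + 1) c, n' + 1, by omega, fun k hk => ?_, by simp,
      fun k hk => ?_⟩
    · rw [Function.update_of_ne (by omega), hagree k hk]
    · rw [Function.update_of_ne (by omega)]
      rcases Nat.lt_succ_iff_lt_or_eq.1 hk with hk | rfl
      · rw [Function.update_of_ne (by omega)]
        exact hs' k hk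
      · simpa [hb] using hbc

/-- Countably many consecutive finite paths can be concatenated. -/
theorem exists_concat_path {α : Type*} {r : α → α → Prop} {G : ℕ → α}
    (h : ∀ i, Relation.ReflTransGen r (G i) (G (i + 1))) :
    ∃ s : ℕ → α, ∃ ν : ℕ → ℕ, Monotone ν ∧ s 0 = G 0 ∧ (∀ i, s (ν i) = G i) ∧
      ∀ i, ∀ k < ν i, r (s k) (s (k + 1)) := by
  let P : ℕ → (ℕ → α) × ℕ → Prop := fun i p =>
    p.1 0 = G 0 ∧ p.1 p.2 = G i ∧ ∀ k < p.2, r (p.1 k) (p.1 (k + 1))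
  have hnext : ∀ i p, ∃ q, P i p → P (i + 1) q ∧ p.2 ≤ q.2 ∧ ∀ k ≤ p.2, q.1 k = p.1 k := by
    intro i p
    by_cases hp : P i p
    · obtain ⟨h0, h1, h2⟩ := hp
      obtain ⟨s', n', hn, hagree, hb, hs'⟩ := extend_path h2 (h1 ▸ h i)
      exact ⟨(s', n'), fun _ => ⟨⟨(hagree 0 (by omega)).trans h0, hb, hs'⟩, hn, hagree⟩⟩
    · exact ⟨p, fun h => absurd h hp⟩
  choose f hf using hnext
  let p : ℕ → (ℕ → α) × ℕ := fun i => Nat.rec (fun _ => G 0, 0) (fun i q => f i q) i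
  have hP : ∀ i, P i (p i) := by
    intro i
    induction i with
    | zero => exact ⟨rfl, rfl, fun k hk => absurd hk (by simp [p])⟩
    | succ i ih => exact (hf i (p i) ih).1
  have hmono : Monotone fun i => (p i).2 :=
    monotone_nat_of_le_succ fun i => (hf i (p i) (hP i)).2.1
  have hagree : ∀ i j, i ≤ j → ∀ k ≤ (p i).2, (p j).1 k = (p i).1 k := by
    intro i j hij
    induction j, hij using Nat.le_induction with
    | base => exact fun _ _ => rfl
    | succ j hij ih =>
      intro k hk
      rw [← ih k hk]
      exact (hf j (p j) (hP j)).2.2 k (hk.trans (hmono hij))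
  let I : ℕ → ℕ := fun n => if h : ∃ i, n ≤ (p i).2 then Nat.find h else 0
  have hs : ∀ i, ∀ k ≤ (p i).2, (p (I k)).1 k = (p i).1 k := by
    intro i k hk
    have hex : ∃ i, k ≤ (p i).2 := ⟨i, hk⟩
    have hI : I k = Nat.find hex := dif_pos hex
    rw [hI]
    exact (hagree _ i (Nat.find_min' hex hk) k (Nat.find_spec hex)).symm
  refine ⟨fun n => (p (I n)).1 n, fun i => (p i).2, hmono, (hP (I 0)).1, fun i => ?_,
    fun i k hk => ?_⟩
  · exact (hs i _ le_rfl).trans (hP i).2.1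
  · beta_reduce at hk ⊢
    rw [hs i k hk.le, hs i (k + 1) hk]
    exact (hP i).2.2 k hk

theorem exists_derivation {𝓡 : RuleSet} {s : ℕ → FactBase} {len : ℕ∞}
    (hs : ∀ i : ℕ, (i : ℕ∞) < len → Step 𝓡 (s i) (s (i + 1)))
    (hstall : ∀ i : ℕ, ¬ (i : ℕ∞) < len → s (i + 1) = s i) :
    ∃ D : Derivation 𝓡 (s 0), D.len = len ∧ D.fb = s ∧ D.IsX .R ∧ D.DatalogFirst := by
  have : ∀ i : ℕ, ∃ t : Trigger, (i : ℕ∞) < len → t.rule ∈ 𝓡 ∧ t.IsOn (s i) ∧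
      Applicable .R t (s i) ∧ (¬ t.rule.IsDatalog → Saturated 𝓡 ↑(s i)) ∧
      s (i + 1) = s i ∪ t.out := by
    intro i
    by_cases hi : (i : ℕ∞) < len
    · obtain ⟨t, ht⟩ := hs i hi
      exact ⟨t, fun _ => ht⟩
    · exact ⟨⟨⟨{⟨0, []⟩}, {⟨0, []⟩}, by simp, by simp⟩, Term.var⟩, fun h => absurd h hi⟩
  choose tr htr using this
  exact ⟨{ len := len
           fb := s
           tr := tr
           fb_zero := rfl
           rule_mem := fun i hi => (htr i hi).1
           trig_on := fun i hi => (htr i hi).2.1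
           trig_new := fun i hi h => not_applicable_of_subset h (htr i hi).2.2.1
           fb_succ := fun i hi => (htr i hi).2.2.2.2
           fb_stall := hstall },
    rfl, rfl, fun i hi => (htr i hi).2.2.1, fun i hi => (htr i hi).2.2.2.1⟩

namespace Derivation

variable {𝓡 : RuleSet} {F : FactBase} {D : Derivation 𝓡 F}

theorem step (hX : D.IsX .R) (hD : D.DatalogFirst) {i : ℕ} (hi : (i : ℕ∞) < D.len) :
    Step 𝓡 (D.fb i) (D.fb (i + 1)) :=
  ⟨D.tr i, D.rule_mem i hi, D.trig_on i hi, hX i hi, hD i hi, D.fb_succ i hi⟩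

theorem steps (hX : D.IsX .R) (hD : D.DatalogFirst) {i j : ℕ} (hij : i ≤ j) :
    Relation.ReflTransGen (Step 𝓡) (D.fb i) (D.fb j) := by
  induction j, hij using Nat.le_induction with
  | base => exact .refl
  | succ j _ ih =>
    by_cases hj : (j : ℕ∞) < D.len
    · exact ih.tail (step hX hD hj)
    · rwa [D.fb_stall j hj]

theorem fb_mono (D : Derivation 𝓡 F) : Monotone D.fb := by
  refine monotone_nat_of_le_succ fun i => ?_
  by_cases hi : (i : ℕ∞) < D.len
  · rw [D.fb_succ i hi]
    exact Finset.subset_union_left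
  · rw [D.fb_stall i hi]

/-- An infinite derivation uses non-Datalog rules infinitely often. -/
theorem exists_not_isDatalog (hlen : D.len = ⊤) (i : ℕ) :
    ∃ j, i ≤ j ∧ ¬ (D.tr j).rule.IsDatalog := by
  by_contra! hcon
  obtain ⟨N, hN⟩ := exists_isClosure 𝓡 (D.fb i)
  have hlt : ∀ j : ℕ, (j : ℕ∞) < D.len := fun j => by rw [hlen]; exact ENat.natCast_lt_top j
  have hsub : ∀ j, i ≤ j → D.fb j ⊆ N := by
    intro j hij
    induction j, hij using Nat.le_induction with
    | base => exact hN.subset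
    | succ j hij ih =>
      rw [D.fb_succ j (hlt j)]
      refine Finset.union_subset ih ?_
      exact hN.saturated.out_subset (D.rule_mem j (hlt j)) (hcon j hij)
        fun a ha => ih (D.trig_on j (hlt j) a ha)
  have hcard : ∀ k, k ≤ (D.fb (i + k)).card := by
    intro k
    induction k with
    | zero => simp
    | succ k ih =>
      refine Nat.succ_le_of_lt (ih.trans_lt (Finset.card_lt_card ?_))
      rw [← Nat.add_assoc, D.fb_succ _ (hlt _)]
      exact ⟨Finset.subset_union_left,
        fun h => D.trig_new _ (hlt _) (Finset.subset_union_right.trans h)⟩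
  have := hcard (N.card + 1)
  have := Finset.card_le_card (hsub (i + (N.card + 1)) (by omega))
  omega

end Derivation

/-! ### Simulations between rule sets -/

/-- Saturated factbases related by `C` allow the Datalog-first restricted chase with `𝓐` to be
simulated by the one with `𝓑`. -/
structure Simulates (𝓐 𝓑 : RuleSet) (C : FactBase → FactBase → Prop) : Prop where
  saturated : ∀ {F G}, C F G → Saturated 𝓑 ↑G
  step : ∀ {F G}, C F G → ∀ t : Trigger, t.rule ∈ 𝓐 → ¬ t.rule.IsDatalog → t.IsOn F →
    Applicable .R t F →
    ∃ G', Relation.ReflTransGen (Step 𝓑) G G' ∧ G' ≠ G ∧ ∀ F', IsClosure 𝓐 (F ∪ t.out) F' → C F' G'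
  back : ∀ u : Trigger, u.rule ∈ 𝓑 → ¬ u.rule.IsDatalog →
    ∃ t : Trigger, t.rule ∈ 𝓐 ∧ ∀ F G, C F G → u.IsOn G →
      t.IsOn F ∧ (¬ Applicable .R t F → ¬ Applicable .R u G)

theorem IsClosure.congr {𝓡 : RuleSet} {F F₁ F' : FactBase} (h : IsClosure 𝓡 F F')
    (hF : F ⊆ F₁) (hF' : F₁ ⊆ F') {F'' : FactBase} (h₁ : IsClosure 𝓡 F₁ F'') : F'' = F' :=
  Finset.Subset.antisymm (h₁.least _ hF' h.saturated)
    (h.least _ (fun _ ha => h₁.subset (hF ha)) h₁.saturated)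

theorem IsClosure.eq_of_saturated {𝓡 : RuleSet} {F F' : FactBase} (h : IsClosure 𝓡 F F')
    (hF : Saturated 𝓡 ↑F) : F' = F :=
  Finset.Subset.antisymm (h.least _ subset_rfl hF) h.subset

variable {𝓐 𝓑 : RuleSet} {C : FactBase → FactBase → Prop}

theorem Simulates.exists_path (S : Simulates 𝓐 𝓑 C) {F G : FactBase}
    (hstart : ∃ F' G', IsClosure 𝓐 F F' ∧ Relation.ReflTransGen (Step 𝓑) G G' ∧ C F' G')
    {D : Derivation 𝓐 F} (hX : D.IsX .R) (hD : D.DatalogFirst) :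
    ∃ s : ℕ → FactBase, ∃ ν : ℕ → ℕ, Monotone ν ∧ s 0 = G ∧
      (∀ i, ∀ k < ν i, Step 𝓑 (s k) (s (k + 1))) ∧
      (∀ i F', IsClosure 𝓐 (D.fb i) F' → C F' (s (ν i))) ∧
      ∀ i : ℕ, (i : ℕ∞) < D.len → ¬ (D.tr i).rule.IsDatalog → ν i < ν (i + 1) := by
  obtain ⟨F₀, G₀, hF₀, hG₀, hC₀⟩ := hstart
  let P : ℕ → FactBase → Prop := fun i H => ∀ F', IsClosure 𝓐 (D.fb i) F' → C F' H
  have hnext : ∀ i H, ∃ H', P i H → P (i + 1) H' ∧ Relation.ReflTransGen (Step 𝓑) H H' ∧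
      ((i : ℕ∞) < D.len → ¬ (D.tr i).rule.IsDatalog → H' ≠ H) := by
    intro i H
    by_cases hi : (i : ℕ∞) < D.len
    · obtain ⟨N, hN⟩ := exists_isClosure 𝓐 (D.fb i)
      by_cases hd : (D.tr i).rule.IsDatalog
      · refine ⟨H, fun hP => ⟨fun F' hF' => ?_, .refl, fun _ h => absurd hd h⟩⟩
        rw [D.fb_succ i hi] at hF'
        rw [hN.congr Finset.subset_union_left (Finset.union_subset hN.subset ?_) hF']
        · exact hP N hN
        · exact hN.saturated.out_subset (D.rule_mem i hi) hd
            fun a ha => hN.subset (D.trig_on i hi a ha)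
      · by_cases hP : P i H
        · have hNF := hN.eq_of_saturated (hD i hi hd)
          obtain ⟨H', h1, h2, h3⟩ := S.step (hP N hN) (D.tr i) (D.rule_mem i hi) hd
            (hNF ▸ D.trig_on i hi) (hNF ▸ hX i hi)
          rw [hNF, ← D.fb_succ i hi] at h3
          exact ⟨H', fun _ => ⟨h3, h1, fun _ _ => h2⟩⟩
        · exact ⟨H, fun h => absurd h hP⟩
    · refine ⟨H, fun hP => ⟨fun F' hF' => hP F' ?_, .refl, fun h => absurd h hi⟩⟩
      rwa [D.fb_stall i hi] at hF'
  choose f hf using hnext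
  let H : ℕ → FactBase := fun i => Nat.rec G₀ (fun i H => f i H) i
  have hP : ∀ i, P i (H i) := by
    intro i
    induction i with
    | zero =>
      intro F' hF'
      rw [D.fb_zero] at hF'
      rwa [hF'.unique hF₀]
    | succ i ih => exact (hf i (H i) ih).1
  let K : ℕ → FactBase := fun i => Nat.casesOn i G H
  have hK : ∀ i, Relation.ReflTransGen (Step 𝓑) (K i) (K (i + 1)) := by
    rintro (_ | i)
    · exact hG₀
    · exact (hf i (H i) (hP i)).2.1
  obtain ⟨s, ν, hν, hs0, hsν, hs⟩ := exists_concat_path hK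
  refine ⟨s, fun i => ν (i + 1), fun i j hij => hν (by omega), hs0, fun i => hs (i + 1),
    fun i F' hF' => ?_, fun i hi hd => ?_⟩
  · rw [hsν]
    exact hP i F' hF'
  · refine lt_of_le_of_ne (hν (by omega)) fun h => ?_
    refine (hf i (H i) (hP i)).2.2 hi hd ?_
    have h1 := hsν (i + 1 + 1)
    rw [← show ν (i + 1) = ν (i + 1 + 1) from h, hsν (i + 1)] at h1
    exact h1.symm

theorem Simulates.exists_infinite (S : Simulates 𝓐 𝓑 C) {F G : FactBase}
    (hstart : ∃ F' G', IsClosure 𝓐 F F' ∧ Relation.ReflTransGen (Step 𝓑) G G' ∧ C F' G')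
    {D : Derivation 𝓐 F} (hX : D.IsX .R) (hD : D.DatalogFirst) (hfair : D.Fair .R)
    (hlen : D.len = ⊤) :
    ∃ D' : Derivation 𝓑 G, D'.IsX .R ∧ D'.DatalogFirst ∧ D'.Fair .R ∧ D'.len = ⊤ := by
  obtain ⟨s, ν, hν, rfl, hs, hC, hinc⟩ := S.exists_path hstart hX hD
  have hlt : ∀ j : ℕ, (j : ℕ∞) < D.len := fun j => by rw [hlen]; exact ENat.natCast_lt_top j
  have hunb : ∀ n, ∃ i, n ≤ ν i := by
    intro n
    induction n with
    | zero => exact ⟨0, Nat.zero_le _⟩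
    | succ n ih =>
      obtain ⟨i, hi⟩ := ih
      obtain ⟨j, hij, hj⟩ := D.exists_not_isDatalog hlen i
      exact ⟨j + 1, Nat.succ_le_of_lt ((hi.trans (hν hij)).trans_lt (hinc j (hlt j) hj))⟩
  obtain ⟨D', hl, hfb, hX', hD'⟩ := exists_derivation (𝓡 := 𝓑) (s := s) (len := ⊤)
    (fun i _ => (hunb (i + 1)).elim fun k hk => hs k i hk)
    (fun i hi => absurd (ENat.natCast_lt_top i) hi)
  refine ⟨D', hX', hD', fun n _ u hu hon hap => ?_, hl⟩
  suffices h : ∃ i, n ≤ ν i ∧ ¬ Applicable .R u (s (ν i)) by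
    obtain ⟨i, hi, hna⟩ := h
    refine ⟨ν i, lt_of_le_of_ne hi ?_, by simp [hl], by rwa [hfb]⟩
    rintro rfl
    rw [hfb] at hap
    exact hna hap
  obtain ⟨i, hi⟩ := hunb n
  have hon' : ∀ m, i ≤ m → u.IsOn (s (ν m)) := fun m hm =>
    hfb ▸ hon.mono (D'.fb_mono (hi.trans (hν hm)))
  by_cases hd : u.rule.IsDatalog
  · obtain ⟨N, hN⟩ := exists_isClosure 𝓐 (D.fb i)
    exact ⟨i, hi, (S.saturated (hC i N hN)).not_applicable hu hd (hon' i le_rfl)⟩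
  · obtain ⟨t, ht, hback⟩ := S.back u hu hd
    have hclose : ∀ m, i ≤ m → t.IsOn (D.fb m) → ¬ Applicable .R t (D.fb m) →
        ¬ Applicable .R u (s (ν m)) := by
      intro m hm hton hna
      obtain ⟨N, hN⟩ := exists_isClosure 𝓐 (D.fb m)
      exact (hback _ _ (hC m N hN) (hon' m hm)).2 (not_applicable_of_steps hN.steps hton hna)
    obtain ⟨j, hij, hj⟩ := D.exists_not_isDatalog hlen i
    have hton : t.IsOn (D.fb j) := by
      obtain ⟨N, hN⟩ := exists_isClosure 𝓐 (D.fb j)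
      rw [← hN.eq_of_saturated (hD j (hlt j) hj)]
      exact (hback _ _ (hC j N hN) (hon' j hij)).1
    by_cases hta : Applicable .R t (D.fb j)
    · obtain ⟨m, hm, -, hna⟩ := hfair j (hlt j).le t ht hton hta
      exact ⟨m, hi.trans (hν (hij.trans hm.le)),
        hclose m (hij.trans hm.le) (hton.mono (D.fb_mono hm.le)) hna⟩
    · exact ⟨j, hi.trans (hν hij), hclose j hij hton hta⟩

theorem Simulates.exists_finite (S : Simulates 𝓐 𝓑 C) {F G : FactBase}
    (hstart : ∃ F' G', IsClosure 𝓐 F F' ∧ Relation.ReflTransGen (Step 𝓑) G G' ∧ C F' G')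
    {D : Derivation 𝓐 F} (hX : D.IsX .R) (hD : D.DatalogFirst) (hfair : D.Fair .R)
    (hlen : D.Finite) :
    ∃ D' : Derivation 𝓑 G, D'.IsX .R ∧ D'.DatalogFirst ∧ D'.Fair .R ∧ D'.Finite := by
  obtain ⟨s, ν, hν, rfl, hs, hC, -⟩ := S.exists_path hstart hX hD
  obtain ⟨n, hn⟩ := ENat.ne_top_iff_exists.1 hlen
  have hend : ∀ t : Trigger, t.rule ∈ 𝓐 → t.IsOn (D.fb n) → ¬ Applicable .R t (D.fb n) := by
    intro t ht hon hap
    obtain ⟨j, hj, hjl, -⟩ := hfair n hn.le t ht hon hap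
    rw [← hn] at hjl
    exact absurd (Nat.cast_le.1 hjl) (by omega)
  have hsat : Saturated 𝓐 ↑(D.fb n) := by
    intro R hR hd
    rw [hd.satisfiesRule_iff]
    intro σ hσ
    by_contra hh
    have hon : Trigger.IsOn ⟨R, σ⟩ (D.fb n) := hσ
    refine hend _ hR hon (applicable_of_isDatalog hd hon fun h => hh fun a ha =>
      h (Trigger.mem_out.2 ⟨a, ha, ?_⟩))
    rw [Trigger.ext_eq_map (t := ⟨R, σ⟩) hd]
  obtain ⟨N, hN⟩ := exists_isClosure 𝓐 (D.fb n)
  obtain rfl := hN.eq_of_saturated hsat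
  have hCn := hC n _ hN
  have hend' : ∀ u : Trigger, u.rule ∈ 𝓑 → u.IsOn (s (ν n)) →
      ¬ Applicable .R u (s (ν n)) := by
    intro u hu hon
    by_cases hd : u.rule.IsDatalog
    · exact (S.saturated hCn).not_applicable hu hd hon
    · obtain ⟨t, ht, hback⟩ := S.back u hu hd
      obtain ⟨h1, h2⟩ := hback _ _ hCn hon
      exact h2 (hend t ht h1)
  obtain ⟨D', hl, hfb, hX', hD'⟩ := exists_derivation (𝓡 := 𝓑)
    (s := fun k => s (min k (ν n))) (len := (ν n : ℕ))
    (fun i hi => by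
      have hi' : i < ν n := Nat.cast_lt.1 hi
      simpa [min_eq_left hi'.le, min_eq_left (Nat.succ_le_of_lt hi')] using hs n i hi')
    (fun i hi => by
      have hi' : ν n ≤ i := not_lt.1 fun h => hi (Nat.cast_lt.2 h)
      simp [min_eq_right hi', min_eq_right (hi'.trans (Nat.le_succ i))])
  have hs0 : s (min 0 (ν n)) = s 0 := by simp
  rw [← hs0]
  refine ⟨D', hX', hD', fun i hi u hu hon hap => ?_, by simp [Derivation.Finite, hl]⟩
  have hi' : i ≤ ν n := by rw [hl] at hi; exact Nat.cast_le.1 hi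
  have hfbn : D'.fb (ν n) = s (ν n) := by simp [hfb]
  have hna : ¬ Applicable .R u (D'.fb (ν n)) := by
    have := hon.mono (D'.fb_mono hi')
    rw [hfbn] at this ⊢
    exact hend' u hu this
  exact ⟨ν n, lt_of_le_of_ne hi' fun h => hna (h ▸ hap), by rw [hl], hna⟩

theorem Simulates.cTallDF (S : Simulates 𝓐 𝓑 C)
    (hstart : ∀ F, ∃ G F' G', IsClosure 𝓐 F F' ∧
      Relation.ReflTransGen (Step 𝓑) G G' ∧ C F' G')
    (h : CTallDF .R 𝓑) : CTallDF .R 𝓐 := by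
  intro F D hX hD hfair hlen
  obtain ⟨G, hG⟩ := hstart F
  obtain ⟨D', h1, h2, h3, h4⟩ := S.exists_infinite hG hX hD hfair hlen
  exact h G D' h1 h2 h3 h4

theorem Simulates.cTexDF (S : Simulates 𝓐 𝓑 C)
    (hstart : ∀ G, ∃ F F' G', IsClosure 𝓐 F F' ∧
      Relation.ReflTransGen (Step 𝓑) G G' ∧ C F' G')
    (h : CTexDF .R 𝓐) : CTexDF .R 𝓑 := by
  intro G
  obtain ⟨F, hF⟩ := hstart G
  obtain ⟨D, hX, hD, hfair, hlen⟩ := h F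
  exact S.exists_finite hF hX hD hfair hlen

/-! ### The rules of the two-way atomic decomposition -/

/-- The rule `B → ∃z.X_R(x,z)`. -/
def adRule (𝓡 : RuleSet) (R : Rule) : Rule :=
  ⟨R.body, {xAtom 𝓡 R}, R.body_nonempty, Finset.singleton_nonempty _⟩

/-- The rule `X_R(x,z) → a`. -/
def projRule (𝓡 : RuleSet) (R : Rule) (a : Atom) : Rule :=
  ⟨{xAtom 𝓡 R}, {a}, Finset.singleton_nonempty _, Finset.singleton_nonempty _⟩

/-- The rule `H[x,z] → X_R(x,z)`. -/
def foldRule (𝓡 : RuleSet) (R : Rule) : Rule :=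
  ⟨R.head, {xAtom 𝓡 R}, R.head_nonempty, Finset.singleton_nonempty _⟩

variable {𝓡 : RuleSet} {R S : Rule}

theorem mem_twoAd_iff : S ∈ twoAd 𝓡 ↔ ∃ R ∈ 𝓡,
    S = adRule 𝓡 R ∨ (∃ a ∈ R.head, S = projRule 𝓡 R a) ∨ S = foldRule 𝓡 R := by
  simp only [twoAd, oneAd, oneAdRule, Finset.mem_union, Finset.mem_biUnion, Finset.mem_insert,
    Finset.mem_image, Finset.mem_attach, true_and, Subtype.exists]
  constructor
  · rintro (⟨R, hR, rfl | ⟨a, ha, rfl⟩⟩ | ⟨R, hR, rfl⟩)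
    · exact ⟨R, hR, .inl rfl⟩
    · exact ⟨R, hR, .inr (.inl ⟨a, ha, rfl⟩)⟩
    · exact ⟨R, hR, .inr (.inr rfl)⟩
  · rintro ⟨R, hR, rfl | ⟨a, ha, rfl⟩ | rfl⟩
    · exact .inl ⟨R, hR, .inl rfl⟩
    · exact .inl ⟨R, hR, .inr ⟨a, ha, rfl⟩⟩
    · exact .inr ⟨R, hR, rfl⟩

theorem vars_xAtom : (xAtom 𝓡 R).vars = FactBase.vars R.head := by
  ext v
  rw [mem_vars_iff]
  simp only [xAtom, List.mem_append, List.mem_map, Finset.mem_sort, Term.var.injEq,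
    exists_eq_right, Rule.frontier, Rule.exVars, Finset.mem_inter, Finset.mem_sdiff]
  tauto

theorem factVars_singleton (a : Atom) : FactBase.vars {a} = a.vars := by
  simp [FactBase.vars]

theorem exVars_adRule : (adRule 𝓡 R).exVars = R.exVars := by
  simp [Rule.exVars, adRule, factVars_singleton, vars_xAtom]

theorem isDatalog_adRule_iff : (adRule 𝓡 R).IsDatalog ↔ R.IsDatalog := by
  simp [Rule.IsDatalog, exVars_adRule]

theorem isDatalog_projRule {a : Atom} (ha : a ∈ R.head) : (projRule 𝓡 R a).IsDatalog := by
  simp only [Rule.IsDatalog, Rule.exVars, projRule, factVars_singleton, vars_xAtom,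
    Finset.sdiff_eq_empty_iff_subset]
  exact fun v hv => mem_factVars_iff.2 ⟨a, ha, hv⟩

theorem isDatalog_foldRule : (foldRule 𝓡 R).IsDatalog := by
  simp [Rule.IsDatalog, Rule.exVars, foldRule, factVars_singleton, vars_xAtom]

theorem isHom_singleton {σ : Subst} {a : Atom} {M : Set Atom} :
    IsHom σ ↑({a} : Finset Atom) M ↔ a.subst σ ∈ M := by
  simp [IsHom]

theorem saturated_iff {M : Set Atom} : Saturated 𝓡 M ↔
    ∀ R ∈ 𝓡, R.IsDatalog → ∀ σ : Subst, IsHom σ ↑R.body M → IsHom σ ↑R.head M :=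
  forall₂_congr fun _ _ => forall_congr' fun hd => hd.satisfiesRule_iff

theorem saturated_twoAd_iff {M : Set Atom} : Saturated (twoAd 𝓡) M ↔
    ∀ R ∈ 𝓡, (R.IsDatalog → ∀ σ : Subst, IsHom σ ↑R.body M → (xAtom 𝓡 R).subst σ ∈ M) ∧
      ∀ σ : Subst, (xAtom 𝓡 R).subst σ ∈ M ↔ IsHom σ ↑R.head M := by
  rw [saturated_iff]
  constructor
  · intro h R hR
    refine ⟨fun hd σ hσ => ?_, fun σ => ⟨fun hσ a ha => ?_, fun hσ => ?_⟩⟩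
    · exact isHom_singleton.1 (h (adRule 𝓡 R) (mem_twoAd_iff.2 ⟨R, hR, .inl rfl⟩)
        (isDatalog_adRule_iff.2 hd) σ hσ)
    · exact isHom_singleton.1 (h (projRule 𝓡 R a)
        (mem_twoAd_iff.2 ⟨R, hR, .inr (.inl ⟨a, ha, rfl⟩)⟩) (isDatalog_projRule ha) σ
        (isHom_singleton.2 hσ))
    · exact isHom_singleton.1 (h (foldRule 𝓡 R) (mem_twoAd_iff.2 ⟨R, hR, .inr (.inr rfl)⟩)
        isDatalog_foldRule σ hσ)
  · intro h S hS hd σ hσ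
    obtain ⟨R, hR, rfl | ⟨a, ha, rfl⟩ | rfl⟩ := mem_twoAd_iff.1 hS
    · exact isHom_singleton.2 ((h R hR).1 (isDatalog_adRule_iff.1 hd) σ hσ)
    · exact isHom_singleton.2 (((h R hR).2 σ).1 (isHom_singleton.1 hσ) a ha)
    · exact isHom_singleton.2 (((h R hR).2 σ).2 hσ)

theorem body_pred_mem (hR : R ∈ 𝓡) {a : Atom} (ha : a ∈ R.body) :
    a.pred ∈ RuleSet.predsF 𝓡 :=
  Finset.mem_sup.2 ⟨R, hR, Finset.mem_union_left _ (Finset.mem_image_of_mem _ ha)⟩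

theorem head_pred_mem (hR : R ∈ 𝓡) {a : Atom} (ha : a ∈ R.head) :
    a.pred ∈ RuleSet.predsF 𝓡 :=
  Finset.mem_sup.2 ⟨R, hR, Finset.mem_union_right _ (Finset.mem_image_of_mem _ ha)⟩

theorem lt_of_mem_predsF {p : ℕ} (hp : p ∈ RuleSet.predsF 𝓡) (n : ℕ) :
    p < (RuleSet.predsF 𝓡).sup id + 1 + n := by
  have : p ≤ (RuleSet.predsF 𝓡).sup id := Finset.le_sup (f := id) hp
  omega

theorem freshPred_notMem (𝓡 : RuleSet) (R : Rule) : freshPred 𝓡 R ∉ RuleSet.predsF 𝓡 :=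
  fun h => lt_irrefl _ (lt_of_mem_predsF h (Encodable.encode R))

theorem freshPred_injective (𝓡 : RuleSet) : Function.Injective (freshPred 𝓡) :=
  fun _ _ h => Encodable.encode_injective (Nat.add_left_cancel h)

theorem xAtom_subst_eq {σ τ : Subst} (h : (xAtom 𝓡 R).subst σ = (xAtom 𝓡 S).subst τ) :
    R = S ∧ ∀ a ∈ R.head, ∀ v ∈ a.vars, σ v = τ v := by
  obtain rfl : R = S := freshPred_injective 𝓡 (congrArg Atom.pred h)
  refine ⟨rfl, fun a ha v hv => Atom.subst_eq_subst_iff.1 h v ?_⟩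
  rw [vars_xAtom]
  exact mem_factVars_iff.2 ⟨a, ha, hv⟩

theorem adRule_injective (𝓡 : RuleSet) : Function.Injective (adRule 𝓡) := by
  intro R S h
  have h1 : ({xAtom 𝓡 R} : Finset Atom) = {xAtom 𝓡 S} := congrArg Rule.head h
  exact freshPred_injective 𝓡 (congrArg Atom.pred (Finset.singleton_injective h1))

theorem adRule_notMem (𝓡 : RuleSet) (R : Rule) : adRule 𝓡 R ∉ 𝓡 := fun h =>
  freshPred_notMem 𝓡 R (head_pred_mem h (Finset.mem_singleton_self (xAtom 𝓡 R)))

/-! ### Matching the fresh variables of the two rule sets -/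

/-- The involution on rules exchanging each `R ∈ 𝓡` with `B → ∃z.X_R(x,z)`. -/
def swapRule (𝓡 : RuleSet) (R : Rule) : Rule :=
  if R ∈ 𝓡 then adRule 𝓡 R else if h : ∃ S ∈ 𝓡, adRule 𝓡 S = R then h.choose else R

theorem swapRule_of_mem (hR : R ∈ 𝓡) : swapRule 𝓡 R = adRule 𝓡 R := if_pos hR

theorem swapRule_adRule (hR : R ∈ 𝓡) : swapRule 𝓡 (adRule 𝓡 R) = R := by
  have h : ∃ S ∈ 𝓡, adRule 𝓡 S = adRule 𝓡 R := ⟨R, hR, rfl⟩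
  rw [swapRule, if_neg (adRule_notMem 𝓡 R), dif_pos h]
  exact adRule_injective 𝓡 h.choose_spec.2

theorem swapRule_swapRule (𝓡 : RuleSet) (R : Rule) : swapRule 𝓡 (swapRule 𝓡 R) = R := by
  by_cases hR : R ∈ 𝓡
  · rw [swapRule_of_mem hR, swapRule_adRule hR]
  · by_cases h : ∃ S ∈ 𝓡, adRule 𝓡 S = R
    · obtain ⟨S, hS, rfl⟩ := h
      rw [swapRule_adRule hS, swapRule_of_mem hS]
    · have : swapRule 𝓡 R = R := by rw [swapRule, if_neg hR, dif_neg h]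
      rw [this, this]

/-- The involution on variables exchanging the fresh variables of corresponding triggers. -/
def swapVar (𝓡 : RuleSet) (v : ℕ) : ℕ :=
  if h : ∃ p : Rule × List Term, Encodable.encode p = v.unpair.1 then
    Nat.pair (Encodable.encode (swapRule 𝓡 h.choose.1,
      h.choose.2.map (applyTerm fun w => Term.var (if w < v then swapVar 𝓡 w else w)))) v.unpair.2
  else v
termination_by v

/-- The renaming of variables by `swapVar`. -/
def swapSubst (𝓡 : RuleSet) : Subst := fun v => Term.var (swapVar 𝓡 v)

theorem lt_encode_list {l : List Term} {w : ℕ} (h : Term.var w ∈ l) : w < Encodable.encode l := by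
  induction l with
  | nil => simp at h
  | cons t l ih =>
    rw [Encodable.encode_list_cons, Nat.lt_succ_iff]
    rcases List.mem_cons.1 h with rfl | h
    · have h1 : w ≤ Encodable.encode (Term.var w) := by
        have : Encodable.encode (Term.var w) = 2 * w + 1 := rfl
        omega
      exact h1.trans (Nat.left_le_pair _ _)
    · exact (ih h).le.trans (Nat.right_le_pair _ _)

theorem swapVar_pair (𝓡 : RuleSet) (R : Rule) (l : List Term) (z : ℕ) :
    swapVar 𝓡 (Nat.pair (Encodable.encode (R, l)) z) =
      Nat.pair (Encodable.encode (swapRule 𝓡 R, l.map (applyTerm (swapSubst 𝓡)))) z := by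
  have h : ∃ p : Rule × List Term,
      Encodable.encode p = (Nat.pair (Encodable.encode (R, l)) z).unpair.1 := ⟨(R, l), by simp⟩
  have hp : h.choose = (R, l) := Encodable.encode_injective (by rw [h.choose_spec]; simp)
  rw [swapVar, dif_pos h, hp, Nat.unpair_pair]
  congr 3
  refine List.map_congr_left ?_
  rintro (c | w) hw
  · rfl
  · have : w < Nat.pair (Encodable.encode (R, l)) z :=
      ((lt_encode_list hw).trans_le (Nat.right_le_pair _ _)).trans_le (Nat.left_le_pair _ _)
    exact congrArg Term.var (if_pos this)

theorem swapVar_swapVar (𝓡 : RuleSet) (v : ℕ) : swapVar 𝓡 (swapVar 𝓡 v) = v := by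
  induction v using Nat.strong_induction_on with
  | _ v ih =>
    by_cases h : ∃ p : Rule × List Term, Encodable.encode p = v.unpair.1
    · obtain ⟨⟨R, l⟩, hp⟩ := h
      have hv : v = Nat.pair (Encodable.encode (R, l)) v.unpair.2 := by rw [hp, Nat.pair_unpair]
      generalize v.unpair.2 = z at hv
      subst hv
      rw [swapVar_pair, swapVar_pair, swapRule_swapRule, List.map_map]
      congr 3
      conv_rhs => rw [← List.map_id l]
      refine List.map_congr_left ?_
      rintro (c | w) hw
      · rfl
      · exact congrArg Term.var (ih w
          (((lt_encode_list hw).trans_le (Nat.right_le_pair _ _)).trans_le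
            (Nat.left_le_pair _ _)))
    · have : swapVar 𝓡 v = v := by rw [swapVar, dif_neg h]
      rw [this, this]

theorem swapTerm_swapTerm (𝓡 : RuleSet) (t : Term) :
    applyTerm (swapSubst 𝓡) (applyTerm (swapSubst 𝓡) t) = t := by
  cases t with
  | const c => rfl
  | var v => exact congrArg Term.var (swapVar_swapVar 𝓡 v)

theorem swapAtom_swapAtom (𝓡 : RuleSet) (a : Atom) :
    (a.subst (swapSubst 𝓡)).subst (swapSubst 𝓡) = a := by
  rw [Atom.subst_subst]
  exact Atom.subst_eq_self fun v _ => swapTerm_swapTerm 𝓡 (.var v)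

theorem swapVar_mem_vars_iff {a : Atom} {v : ℕ} :
    swapVar 𝓡 v ∈ (a.subst (swapSubst 𝓡)).vars ↔ v ∈ a.vars := by
  rw [Atom.mem_vars_subst]
  constructor
  · rintro ⟨w, hw, h⟩
    rwa [← swapVar_swapVar 𝓡 v, ← Term.var.inj h, swapVar_swapVar]
  · exact fun h => ⟨v, h, rfl⟩

/-- The trigger for `B → ∃z.X_R(x,z)` corresponding to a trigger for `R`. -/
def adTrigger (𝓡 : RuleSet) (t : Trigger) : Trigger :=
  ⟨adRule 𝓡 t.rule, fun v => applyTerm (swapSubst 𝓡) (t.map v)⟩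

theorem freshVar_adTrigger {t : Trigger} (ht : t.rule ∈ 𝓡) (z : ℕ) :
    (adTrigger 𝓡 t).freshVar z = swapVar 𝓡 (t.freshVar z) := by
  rw [Trigger.freshVar, Trigger.freshVar, swapVar_pair, swapRule_of_mem ht, List.map_map]
  rfl

theorem ext_adTrigger {t : Trigger} (ht : t.rule ∈ 𝓡) (v : ℕ) :
    (adTrigger 𝓡 t).ext v = applyTerm (swapSubst 𝓡) (t.ext v) := by
  have hex : (adTrigger 𝓡 t).rule.exVars = t.rule.exVars := exVars_adRule
  unfold Trigger.ext
  rw [hex]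
  split_ifs
  · rw [freshVar_adTrigger ht]
    rfl
  · rfl

theorem out_adTrigger {t : Trigger} (ht : t.rule ∈ 𝓡) : (adTrigger 𝓡 t).out =
    {(xAtom 𝓡 t.rule).subst fun v => applyTerm (swapSubst 𝓡) (t.ext v)} := by
  rw [← funext (ext_adTrigger ht)]
  simp [Trigger.out, adTrigger, adRule]

/-- Correspondence between saturated factbases for `𝓡` and for `twoAd 𝓡`. -/
structure Corr (𝓡 : RuleSet) (F G : FactBase) : Prop where
  mem_iff : ∀ a : Atom, a.pred ∈ RuleSet.predsF 𝓡 → (a ∈ F ↔ a.subst (swapSubst 𝓡) ∈ G)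
  vars_iff : ∀ v, v ∈ setVars ↑F ↔ swapVar 𝓡 v ∈ setVars ↑G
  saturated_left : Saturated 𝓡 ↑F
  saturated_right : Saturated (twoAd 𝓡) ↑G

theorem Corr.mem_iff' {F G : FactBase} (h : Corr 𝓡 F G) {a : Atom}
    (ha : a.pred ∈ RuleSet.predsF 𝓡) : a.subst (swapSubst 𝓡) ∈ F ↔ a ∈ G := by
  rw [h.mem_iff (a.subst (swapSubst 𝓡)) ha, swapAtom_swapAtom]

theorem Corr.xAtom_mem_iff {F G : FactBase} (h : Corr 𝓡 F G) (hR : R ∈ 𝓡) {σ : Subst} :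
    (xAtom 𝓡 R).subst (fun v => applyTerm (swapSubst 𝓡) (σ v)) ∈ G ↔ IsHom σ ↑R.head ↑F := by
  rw [← Finset.mem_coe, (saturated_twoAd_iff.1 h.saturated_right R hR).2]
  refine forall₂_congr fun a ha => ?_
  rw [← Atom.subst_subst]
  exact (h.mem_iff (a.subst σ) (head_pred_mem (a := a) hR ha)).symm

theorem Corr.isOn_iff {F G : FactBase} (h : Corr 𝓡 F G) {t : Trigger} (ht : t.rule ∈ 𝓡) :
    (adTrigger 𝓡 t).IsOn G ↔ t.IsOn F := by
  refine forall₂_congr fun a ha => ?_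
  simp only [adTrigger]
  rw [← Atom.subst_subst]
  exact (h.mem_iff (a.subst t.map) (body_pred_mem (a := a) ht ha)).symm

theorem Corr.applicable_iff {F G : FactBase} (h : Corr 𝓡 F G) {t : Trigger} (ht : t.rule ∈ 𝓡) :
    Applicable .R (adTrigger 𝓡 t) G ↔ Applicable .R t F := by
  rw [← not_iff_not, not_applicable_iff, not_applicable_iff]
  have hhom : ∀ σ : Subst, (∀ a ∈ t.out, a.subst σ ∈ F) ↔
      IsHom (fun v => applyTerm σ (t.ext v)) ↑t.rule.head ↑F := by
    intro σ
    simp only [Trigger.mem_out, forall_exists_index, and_imp, forall_apply_eq_imp_iff₂, IsHom,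
      Atom.subst_subst]
    rfl
  simp only [hhom, out_adTrigger ht, Finset.mem_singleton, forall_eq, Atom.subst_subst,
    ← h.xAtom_mem_iff ht]
  constructor
  · rintro ⟨σ, h1, h2⟩
    refine ⟨fun v => applyTerm (swapSubst 𝓡) (σ (swapVar 𝓡 v)), fun v hv => ?_, ?_⟩
    · beta_reduce
      rw [h1 _ ((h.vars_iff v).1 hv)]
      exact congrArg Term.var (swapVar_swapVar 𝓡 v)
    · convert h2 using 2
      funext v
      cases t.ext v with
      | const c => rfl
      | var w => exact swapTerm_swapTerm 𝓡 _
  · rintro ⟨σ, h1, h2⟩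
    refine ⟨fun v => applyTerm (swapSubst 𝓡) (σ (swapVar 𝓡 v)), fun v hv => ?_, ?_⟩
    · beta_reduce
      rw [h1 _ ((h.vars_iff _).2 (by rwa [swapVar_swapVar]))]
      exact congrArg Term.var (swapVar_swapVar 𝓡 v)
    · convert h2 using 2
      funext v
      cases t.ext v with
      | const c => rfl
      | var w => simp [applyTerm, swapSubst, swapVar_swapVar]

/-- Datalog closures of matching factbases correspond. -/
theorem corr_of_isClosure {F G F' G' : FactBase} (hF : IsClosure 𝓡 F F')
    (hG : IsClosure (twoAd 𝓡) G G')
    (hFG : ∀ a ∈ F, a.pred ∈ RuleSet.predsF 𝓡 → a.subst (swapSubst 𝓡) ∈ G')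
    (hGF : ∀ a ∈ G, a.pred ∈ RuleSet.predsF 𝓡 → a.subst (swapSubst 𝓡) ∈ F)
    (hX : ∀ R ∈ 𝓡, ∀ σ : Subst, (xAtom 𝓡 R).subst σ ∈ G →
      ∀ a ∈ R.head, (a.subst σ).subst (swapSubst 𝓡) ∈ F)
    (hvars : ∀ v, v ∈ setVars ↑F ↔ swapVar 𝓡 v ∈ setVars ↑G) : Corr 𝓡 F' G' := by
  have h1 : ↑F' ⊆ {a : Atom | a.pred ∈ RuleSet.predsF 𝓡 → a.subst (swapSubst 𝓡) ∈ G'} := by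
    refine hF.least _ hFG (saturated_iff.2 fun R hR hd σ hσ a ha _ => ?_)
    have hsat := saturated_twoAd_iff.1 hG.saturated R hR
    rw [Atom.subst_subst]
    refine (hsat.2 _).1 (hsat.1 hd _ fun b hb => ?_) a ha
    rw [← Atom.subst_subst]
    exact hσ b hb (body_pred_mem (a := b) hR hb)
  have h2 : ↑G' ⊆ {a : Atom | (a.pred ∈ RuleSet.predsF 𝓡 → a.subst (swapSubst 𝓡) ∈ F') ∧
      ∀ R ∈ 𝓡, ∀ σ : Subst, (xAtom 𝓡 R).subst σ = a →
        ∀ b ∈ R.head, (b.subst σ).subst (swapSubst 𝓡) ∈ F'} := by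
    refine hG.least _ (fun a ha => ⟨fun hp => hF.subset (hGF a ha hp), fun R hR σ h b hb =>
      hF.subset (hX R hR σ (h ▸ ha) b hb)⟩) (saturated_twoAd_iff.2 fun R hR => ?_)
    have hxmem : ∀ σ : Subst, (∀ b ∈ R.head, (b.subst σ).subst (swapSubst 𝓡) ∈ F') →
        (xAtom 𝓡 R).subst σ ∈ {a : Atom | (a.pred ∈ RuleSet.predsF 𝓡 →
          a.subst (swapSubst 𝓡) ∈ F') ∧ ∀ R ∈ 𝓡, ∀ σ : Subst, (xAtom 𝓡 R).subst σ = a →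
            ∀ b ∈ R.head, (b.subst σ).subst (swapSubst 𝓡) ∈ F'} := by
      refine fun σ hσ => ⟨fun hp => absurd hp (freshPred_notMem 𝓡 R), fun S _ τ h b hb => ?_⟩
      obtain ⟨rfl, h'⟩ := xAtom_subst_eq h
      rw [Atom.subst_eq_subst_iff.2 (h' b hb)]
      exact hσ b hb
    refine ⟨fun hd σ hσ => hxmem σ fun b hb => ?_, fun σ => ⟨fun hσ b hb => ⟨fun _ =>
      hσ.2 R hR σ rfl b hb, fun S _ τ h => ?_⟩, fun hσ => hxmem σ fun b hb =>
      (hσ b hb).1 (head_pred_mem (a := b) hR hb)⟩⟩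
    · rw [Atom.subst_subst]
      refine saturated_iff.1 hF.saturated R hR hd _ (fun c hc => ?_) b hb
      rw [← Atom.subst_subst]
      exact (hσ c hc).1 (body_pred_mem (a := c) hR hc)
    · have : freshPred 𝓡 S = b.pred := congrArg Atom.pred h
      exact absurd (this ▸ head_pred_mem hR hb) (freshPred_notMem 𝓡 S)
  refine ⟨fun a ha => ⟨fun h => h1 h ha, fun h => ?_⟩, ?_, hF.saturated, hG.saturated⟩
  · simpa [swapAtom_swapAtom] using (h2 h).1 ha
  · rwa [hF.setVars_eq, hG.setVars_eq]

theorem setVars_union (F G : FactBase) : setVars ↑(F ∪ G) = setVars ↑F ∪ setVars ↑G := by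
  ext v
  simp [setVars, or_and_right, exists_or]

theorem Corr.step {F G F' G' : FactBase} (h : Corr 𝓡 F G) {t : Trigger} (ht : t.rule ∈ 𝓡)
    (hF : IsClosure 𝓡 (F ∪ t.out) F')
    (hG : IsClosure (twoAd 𝓡) (G ∪ (adTrigger 𝓡 t).out) G') : Corr 𝓡 F' G' := by
  rw [out_adTrigger ht] at hG
  have hmem : (xAtom 𝓡 t.rule).subst (fun v => applyTerm (swapSubst 𝓡) (t.ext v)) ∈ G' :=
    hG.subset (by simp)
  refine corr_of_isClosure hF hG ?_ ?_ ?_ ?_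
  · intro a ha hp
    rcases Finset.mem_union.1 ha with ha | ha
    · exact hG.subset (Finset.mem_union_left _ ((h.mem_iff a hp).1 ha))
    · obtain ⟨b, hb, rfl⟩ := Trigger.mem_out.1 ha
      rw [Atom.subst_subst]
      exact ((saturated_twoAd_iff.1 hG.saturated _ ht).2 _).1 hmem b hb
  · intro a ha hp
    rcases Finset.mem_union.1 ha with ha | ha
    · exact Finset.mem_union_left _ ((h.mem_iff' hp).2 ha)
    · obtain rfl := Finset.mem_singleton.1 ha
      exact absurd hp (freshPred_notMem 𝓡 t.rule)
  · intro R hR σ hσ a ha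
    rcases Finset.mem_union.1 hσ with hσ | hσ
    · exact Finset.mem_union_left _ ((h.mem_iff' (a := a.subst σ) (head_pred_mem (a := a) hR ha)).2
        (((saturated_twoAd_iff.1 h.saturated_right R hR).2 σ).1 hσ a ha))
    · obtain ⟨rfl, h'⟩ := xAtom_subst_eq (Finset.mem_singleton.1 hσ)
      refine Finset.mem_union_right _ (Trigger.mem_out.2 ⟨a, ha, ?_⟩)
      rw [Atom.subst_eq_subst_iff.2 (h' a ha), ← Atom.subst_subst, swapAtom_swapAtom]
  · intro v
    rw [setVars_union, setVars_union, Set.mem_union, Set.mem_union, h.vars_iff v]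
    refine or_congr_right ?_
    have : swapVar 𝓡 v ∈ setVars ↑({(xAtom 𝓡 t.rule).subst fun v =>
        applyTerm (swapSubst 𝓡) (t.ext v)} : Finset Atom) ↔
        v ∈ ((xAtom 𝓡 t.rule).subst t.ext).vars := by
      rw [← Atom.subst_subst, ← swapVar_mem_vars_iff (𝓡 := 𝓡)]
      simp [setVars]
    rw [this, Atom.mem_vars_subst, vars_xAtom]
    constructor
    · rintro ⟨a, ha, hv⟩
      obtain ⟨b, hb, rfl⟩ := Trigger.mem_out.1 ha
      obtain ⟨w, hw, hwv⟩ := Atom.mem_vars_subst.1 hv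
      exact ⟨w, mem_factVars_iff.2 ⟨b, hb, hw⟩, hwv⟩
    · rintro ⟨w, hw, hwv⟩
      obtain ⟨b, hb, hw⟩ := mem_factVars_iff.1 hw
      exact ⟨_, Trigger.mem_out.2 ⟨b, hb, rfl⟩, Atom.mem_vars_subst.2 ⟨w, hw, hwv⟩⟩

/-- A non-Datalog trigger for `twoAd 𝓡` corresponds to a trigger for `𝓡`. -/
theorem exists_eq_adTrigger {u : Trigger} (hu : u.rule ∈ twoAd 𝓡) (hd : ¬ u.rule.IsDatalog) :
    ∃ t : Trigger, t.rule ∈ 𝓡 ∧ ¬ t.rule.IsDatalog ∧ adTrigger 𝓡 t = u := by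
  obtain ⟨S, π⟩ := u
  obtain ⟨R, hR, rfl | ⟨a, ha, rfl⟩ | rfl⟩ := mem_twoAd_iff.1 hu
  · refine ⟨⟨R, fun v => applyTerm (swapSubst 𝓡) (π v)⟩, hR,
      fun h => hd (isDatalog_adRule_iff.2 h), ?_⟩
    simp [adTrigger, swapTerm_swapTerm]
  · exact absurd (isDatalog_projRule ha) hd
  · exact absurd isDatalog_foldRule hd

theorem adTrigger_rule_mem {t : Trigger} (ht : t.rule ∈ 𝓡) :
    (adTrigger 𝓡 t).rule ∈ twoAd 𝓡 :=
  mem_twoAd_iff.2 ⟨_, ht, .inl rfl⟩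

theorem exists_steps_of_applicable {F : FactBase} {t : Trigger} (ht : t.rule ∈ 𝓡)
    (hF : t.IsOn F) (hap : Applicable .R t F) (hsat : Saturated 𝓡 ↑F) :
    ∃ F', IsClosure 𝓡 (F ∪ t.out) F' ∧ Relation.ReflTransGen (Step 𝓡) F F' ∧ F' ≠ F := by
  obtain ⟨F', h⟩ := exists_isClosure 𝓡 (F ∪ t.out)
  refine ⟨F', h, .head ⟨t, ht, hF, hap, fun _ => hsat, rfl⟩ h.steps, ?_⟩
  rintro rfl
  exact not_applicable_of_subset (Finset.subset_union_right.trans h.subset) hap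

theorem simulates_twoAd (𝓡 : RuleSet) : Simulates 𝓡 (twoAd 𝓡) (Corr 𝓡) where
  saturated h := h.saturated_right
  step h t ht _ hon hap := by
    obtain ⟨G', h1, h2, h3⟩ := exists_steps_of_applicable (adTrigger_rule_mem ht)
      ((h.isOn_iff ht).2 hon) ((h.applicable_iff ht).2 hap) h.saturated_right
    exact ⟨G', h2, h3, fun F' hF' => h.step ht hF' h1⟩
  back u hu hd := by
    obtain ⟨t, ht, -, rfl⟩ := exists_eq_adTrigger hu hd
    exact ⟨t, ht, fun F G h hon =>
      ⟨(h.isOn_iff ht).1 hon, fun hn => by rwa [h.applicable_iff ht]⟩⟩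

theorem twoAd_simulates (𝓡 : RuleSet) :
    Simulates (twoAd 𝓡) 𝓡 (fun G F => Corr 𝓡 F G) where
  saturated h := h.saturated_left
  step h u hu hd hon hap := by
    obtain ⟨t, ht, -, rfl⟩ := exists_eq_adTrigger hu hd
    obtain ⟨F', h1, h2, h3⟩ := exists_steps_of_applicable ht ((h.isOn_iff ht).1 hon)
      ((h.applicable_iff ht).1 hap) h.saturated_left
    exact ⟨F', h2, h3, fun G' hG' => h.step ht h1 hG'⟩
  back t ht _ := ⟨adTrigger 𝓡 t, adTrigger_rule_mem ht, fun G F h hon =>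
    ⟨(h.isOn_iff ht).2 hon, fun hn => by rwa [h.applicable_iff ht] at hn⟩⟩

/-- Every saturated factbase for `twoAd 𝓡` corresponds to its renaming. -/
theorem corr_image_swap {G : FactBase} (hG : Saturated (twoAd 𝓡) ↑G) :
    Corr 𝓡 (G.image (Atom.subst (swapSubst 𝓡))) G := by
  have hmem : ∀ a : Atom, a ∈ G.image (Atom.subst (swapSubst 𝓡)) ↔
      a.subst (swapSubst 𝓡) ∈ G := by
    intro a
    rw [Finset.mem_image]
    constructor
    · rintro ⟨b, hb, rfl⟩
      rwa [swapAtom_swapAtom]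
    · exact fun h => ⟨_, h, swapAtom_swapAtom 𝓡 a⟩
  refine ⟨fun a _ => hmem a, fun v => ⟨?_, ?_⟩, saturated_iff.2 fun R hR hd σ hσ a ha => ?_, hG⟩
  · rintro ⟨a, ha, hv⟩
    exact ⟨_, (hmem a).1 ha, swapVar_mem_vars_iff.2 hv⟩
  · rintro ⟨a, ha, hv⟩
    refine ⟨_, Finset.mem_image_of_mem _ ha, ?_⟩
    rwa [← swapVar_mem_vars_iff (𝓡 := 𝓡), swapAtom_swapAtom]
  · have hsat := saturated_twoAd_iff.1 hG R hR
    rw [Finset.mem_coe, hmem, Atom.subst_subst]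
    refine (hsat.2 _).1 (hsat.1 hd _ fun b hb => ?_) a ha
    rw [← Atom.subst_subst]
    exact (hmem _).1 (hσ b hb)

/-- For every factbase there is a factbase for `twoAd 𝓡` with a corresponding Datalog
closure. -/
theorem exists_corr_closures (𝓡 : RuleSet) (F : FactBase) : ∃ G F' G',
    IsClosure 𝓡 F F' ∧ IsClosure (twoAd 𝓡) G G' ∧ Corr 𝓡 F' G' := by
  let p : ℕ := (RuleSet.predsF 𝓡).sup id + 1 + (𝓡.sup Encodable.encode + 1)
  have hp : p ∉ RuleSet.predsF 𝓡 := fun h => lt_irrefl _ (lt_of_mem_predsF h _)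
  have hpX : ∀ R ∈ 𝓡, freshPred 𝓡 R ≠ p := fun R hR h => by
    have h1 : Encodable.encode R = 𝓡.sup Encodable.encode + 1 := Nat.add_left_cancel h
    have h2 : Encodable.encode R ≤ 𝓡.sup Encodable.encode := Finset.le_sup hR
    omega
  let G : FactBase := (F.filter fun a => a.pred ∈ RuleSet.predsF 𝓡).image
      (Atom.subst (swapSubst 𝓡)) ∪
    F.image fun a => ⟨p, (a.subst (swapSubst 𝓡)).args⟩
  have hmem : ∀ b, b ∈ G ↔ (∃ a ∈ F, a.pred ∈ RuleSet.predsF 𝓡 ∧ a.subst (swapSubst 𝓡) = b) ∨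
      ∃ a ∈ F, (⟨p, (a.subst (swapSubst 𝓡)).args⟩ : Atom) = b := by
    intro b
    simp [G, and_assoc]
  obtain ⟨F', hF'⟩ := exists_isClosure 𝓡 F
  obtain ⟨G', hG'⟩ := exists_isClosure (twoAd 𝓡) G
  refine ⟨G, F', G', hF', hG', corr_of_isClosure hF' hG' ?_ ?_ ?_ ?_⟩
  · exact fun a ha hpa => hG'.subset ((hmem _).2 (.inl ⟨a, ha, hpa, rfl⟩))
  · intro b hb hpb
    obtain ⟨a, ha, -, rfl⟩ | ⟨a, -, rfl⟩ := (hmem b).1 hb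
    · rwa [swapAtom_swapAtom]
    · exact absurd hpb hp
  · intro R hR σ hσ
    obtain ⟨a, -, hpa, h⟩ | ⟨a, -, h⟩ := (hmem _).1 hσ
    · have : a.pred = freshPred 𝓡 R := congrArg Atom.pred h
      exact absurd (this ▸ hpa) (freshPred_notMem 𝓡 R)
    · exact absurd (congrArg Atom.pred h).symm (hpX R hR)
  · intro v
    have hargs : ∀ a : Atom, swapVar 𝓡 v ∈ (⟨p, (a.subst (swapSubst 𝓡)).args⟩ : Atom).vars ↔
        v ∈ a.vars := fun a => by
      rw [mem_vars_iff, ← swapVar_mem_vars_iff (𝓡 := 𝓡), mem_vars_iff]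
    constructor
    · rintro ⟨a, ha, hv⟩
      exact ⟨_, (hmem _).2 (.inr ⟨a, ha, rfl⟩), (hargs a).2 hv⟩
    · rintro ⟨b, hb, hv⟩
      obtain ⟨a, ha, -, rfl⟩ | ⟨a, ha, rfl⟩ := (hmem b).1 hb
      · exact ⟨a, ha, swapVar_mem_vars_iff.1 hv⟩
      · exact ⟨a, ha, (hargs a).1 hv⟩

/-- The two-way atomic decomposition has no impact on
(sometimes-)termination of the Datalog-first restricted chase. -/
theorem statement15 (𝓡 : RuleSet) :
    (CTallDF Variant.R 𝓡 ↔ CTallDF Variant.R (twoAd 𝓡)) ∧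
    (CTexDF Variant.R 𝓡 ↔ CTexDF Variant.R (twoAd 𝓡)) := by
  refine ⟨⟨(twoAd_simulates 𝓡).cTallDF fun G => ?_, (simulates_twoAd 𝓡).cTallDF fun F => ?_⟩,
    ⟨(simulates_twoAd 𝓡).cTexDF fun G => ?_, (twoAd_simulates 𝓡).cTexDF fun F => ?_⟩⟩
  · obtain ⟨N, hN⟩ := exists_isClosure (twoAd 𝓡) G
    exact ⟨_, N, _, hN, .refl, corr_image_swap hN.saturated⟩
  · obtain ⟨G, F', G', hF, hG, h⟩ := exists_corr_closures 𝓡 F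
    exact ⟨G, F', G', hF, hG.steps, h⟩
  · obtain ⟨N, hN⟩ := exists_isClosure (twoAd 𝓡) G
    have h := corr_image_swap hN.saturated
    exact ⟨_, _, N, ⟨.refl, h.saturated_left, fun _ hM _ => hM⟩, hN.steps, h⟩
  · obtain ⟨G, F', G', hF, hG, h⟩ := exists_corr_closures 𝓡 F
    exact ⟨G, G', F', hG, hF.steps, h⟩

end
end ExRules
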